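/- arXiv:1910.01322 — 2 statements merged into one kernel-verified Lean document; each statement's English description precedes it below -/
import Mathlib

section
/- For all integers n, r, k with r ≥ k ≥ 3, every r-uniform hypergraph on n vertices containing no Berge-path of length k has at most (k−1)n/(r+1) hyperedges; moreover, if the number of hyperedges equals (k−1)n/(r+1), then (r+1) divides n. -/
open scoped Classical

/-- A Berge-path of length `t` in the hypergraph `H` (a family of hyperedges):
an alternating sequence of `t+1` distinct vertices and `t` distinct hyperedges
`v₁, e₁, …, e_t, v_{t+1}` with `vᵢ, vᵢ₊₁ ∈ eᵢ`. -/
structure BergePath {V : Type*} (H : Finset (Finset V)) (t : ℕ) where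
  verts : Fin (t + 1) → V
  edges : Fin t → Finset V
  verts_inj : Function.Injective verts
  edges_inj : Function.Injective edges
  edges_mem : ∀ i, edges i ∈ H
  fst_mem : ∀ i : Fin t, verts i.castSucc ∈ edges i
  snd_mem : ∀ i : Fin t, verts i.succ ∈ edges i

/-- A Berge-cycle of length `t` in the hypergraph `H`: `t` distinct vertices and
`t` distinct hyperedges with `vᵢ, vᵢ₊₁ ∈ eᵢ`, indices mod `t`. -/
structure BergeCycle {V : Type*} (H : Finset (Finset V)) (t : ℕ) where
  verts : Fin t → V
  edges : Fin t → Finset V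
  verts_inj : Function.Injective verts
  edges_inj : Function.Injective edges
  edges_mem : ∀ i, edges i ∈ H
  fst_mem : ∀ i, verts i ∈ edges i
  snd_mem : ∀ i : Fin t, verts ⟨(i.val + 1) % t, Nat.mod_lt _ i.pos⟩ ∈ edges i

/-- `u` and `v` are joined by a Berge-path of `H`. -/
def BergeReachable {V : Type*} (H : Finset (Finset V)) (u v : V) : Prop :=
  ∃ t, ∃ P : BergePath H t, P.verts 0 = u ∧ P.verts (Fin.last t) = v

/-- A hypergraph on the vertex type `V` is connected if any two vertices are joined
by a Berge-path. -/
def HConnected {V : Type*} (H : Finset (Finset V)) : Prop :=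
  ∀ u v : V, u ≠ v → BergeReachable H u v

/-- The degree of a vertex: the number of hyperedges containing it. -/
noncomputable def hdeg {V : Type*} (H : Finset (Finset V)) (v : V) : ℕ :=
  (H.filter (fun e => v ∈ e)).card

/-- The vertex neighborhood of `v` in `H`. -/
noncomputable def nbhd {V : Type*} [Fintype V] (H : Finset (Finset V)) (v : V) : Finset V :=
  Finset.univ.filter (fun u => u ≠ v ∧ ∃ e ∈ H, v ∈ e ∧ u ∈ e)

/-- The sub-hypergraph induced by a set `S` of vertices: all hyperedges lying inside `S`. -/
noncomputable def restrictTo {V : Type*} (H : Finset (Finset V)) (S : Finset V) :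
    Finset (Finset V) :=
  H.filter (fun e => e ⊆ S)

/-- `DelProcess H D S T` : starting from the vertex set `S`, the vertex set `T` can be
reached by repeatedly deleting a vertex whose degree in the current induced
sub-hypergraph is less than `D` (together with all hyperedges containing it). -/
inductive DelProcess {V : Type*} (H : Finset (Finset V)) (D : ℕ) :
    Finset V → Finset V → Prop
  | refl (S : Finset V) : DelProcess H D S S
  | step (S T : Finset V) (v : V) (hv : v ∈ S)
      (hd : hdeg (restrictTo H S) v < D)
      (h : DelProcess H D (S.erase v) T) : DelProcess H D S T

/-- The edge family of `H_{n,k}` for odd `k`, on vertex set `S` with kernel `A`: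
all `r`-subsets of `S` having at most one vertex outside `A`. -/
noncomputable def HnkFamilyOdd {V : Type*} (r : ℕ) (S A : Finset V) : Finset (Finset V) :=
  S.powerset.filter (fun s => s.card = r ∧ (s \ A).card ≤ 1)

/-- The edge family of `H_{n,k}` for even `k`: additionally all `r`-subsets consisting of
`b1`, `b2` and `r-2` vertices of `A`. -/
noncomputable def HnkFamilyEven {V : Type*} (r : ℕ) (S A : Finset V) (b1 b2 : V) :
    Finset (Finset V) :=
  S.powerset.filter (fun s => s.card = r ∧ ((s \ A).card ≤ 1 ∨ s \ A = {b1, b2}))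

/-- `H` is (a copy of) the extremal hypergraph `H_{m,k}` on the vertex set `S`
(where `m = |S|`). Note that `⌊(k-1)/2⌋` equals `(k-1)/2` in ℕ for odd `k`,
and `(k-2)/2` for even `k`. -/
def IsHnkOn {V : Type*} (r k : ℕ) (S : Finset V) (H : Finset (Finset V)) : Prop :=
  ∃ A ⊆ S, A.card = (k - 1) / 2 ∧
    ((Odd k ∧ H = HnkFamilyOdd r S A) ∨
     (Even k ∧ ∃ b1 ∈ S \ A, ∃ b2 ∈ S \ A, b1 ≠ b2 ∧ H = HnkFamilyEven r S A b1 b2))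

/-- The extremal number of hyperedges:
`C(⌊(k-1)/2⌋, r-1)·(n − ⌊(k-1)/2⌋) + C(⌊(k-1)/2⌋, r) + [2 ∣ k]·C(⌊(k-1)/2⌋, r-2)`. -/
def extremalCount (r k n : ℕ) : ℕ :=
  ((k - 1) / 2).choose (r - 1) * (n - (k - 1) / 2) + ((k - 1) / 2).choose r +
    (if 2 ∣ k then ((k - 1) / 2).choose (r - 2) else 0)

/-- The threshold `N_{k,r}`. -/
def Nkr (r k : ℕ) : ℕ :=
  (r * (k - 1)).choose r + ((k - 1) / 2).choose (r - 1) * ((k - 1) / 2)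
    - ((k - 1) / 2).choose r - (if 2 ∣ k then ((k - 1) / 2).choose (r - 2) else 0)
    + r * (k - 1)

/-- The hyperedges of `F`, listed without repetition as `e 0, …, e (t - 1)`, together with distinct
connecting vertices `c 1, …, c (t - 1)`, where `c i` lies in both `e (i - 1)` and `e i`. -/
structure EdgePath {V : Type*} (F : Finset (Finset V)) (t : ℕ) (c : ℕ → V)
    (e : ℕ → Finset V) : Prop where
  image_eq : (Finset.range t).image e = F
  edges_inj : ∀ i j, i < t → j < t → e i = e j → i = j
  conn_inj : ∀ i j, 1 ≤ i → i < t → 1 ≤ j → j < t → c i = c j → i = j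
  left : ∀ i, i + 1 < t → c (i + 1) ∈ e i
  right : ∀ i, i + 1 < t → c (i + 1) ∈ e (i + 1)

/-- The set of connecting vertices of an edge path of length `t`. -/
noncomputable def connectors {V : Type*} (t : ℕ) (c : ℕ → V) : Finset V :=
  (Finset.Ico 1 t).image c

/-- The connecting vertices after reversing the first `j` edges and reattaching them through `u`. -/
def rotConn {V : Type*} (j : ℕ) (u : V) (c : ℕ → V) (i : ℕ) : V :=
  if i < j then c (j - i) else if i = j then u else c i

/-- The edges after reversing the first `j` edges. -/
def rotEdge {V : Type*} (j : ℕ) (e : ℕ → Finset V) (i : ℕ) : Finset V :=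
  if i < j then e (j - 1 - i) else e i

/-- The family `H` contains no edge path with `k` edges. -/
def NoEdgePath {V : Type*} (H : Finset (Finset V)) (k : ℕ) : Prop :=
  ∀ F ⊆ H, ∀ c e, ¬ EdgePath F k c e

/-- The family `H` contains no edge path with `t` edges that closes up to a cycle. -/
def NoEdgeCycle {V : Type*} (H : Finset (Finset V)) (t : ℕ) : Prop :=
  ∀ F ⊆ H, ∀ c e, EdgePath F t c e → ∀ x ∈ e 0, x ∈ e (t - 1) → x ∈ connectors t c

/-- The free vertices of the first edge, over all edge paths that arrange `F` with last edge `l`. -/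
noncomputable def freeEnds {V : Type*} [Fintype V] (F : Finset (Finset V)) (l : Finset V) (t : ℕ) :
    Finset V :=
  Finset.univ.filter fun x => ∃ c e, EdgePath F t c e ∧ e (t - 1) = l ∧ x ∈ e 0 \ connectors t c

section EdgePath

variable {V : Type*} {F H : Finset (Finset V)} {t r k : ℕ} {c : ℕ → V} {e : ℕ → Finset V}

lemma mem_connectors {x : V} : x ∈ connectors t c ↔ ∃ i, 1 ≤ i ∧ i < t ∧ c i = x := by
  simp [connectors, and_assoc]

lemma EdgePath.mem (h : EdgePath F t c e) {i : ℕ} (hi : i < t) : e i ∈ F := by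
  rw [← h.image_eq]
  exact Finset.mem_image_of_mem _ (Finset.mem_range.2 hi)

lemma EdgePath.exists_of_mem (h : EdgePath F t c e) {f : Finset V} (hf : f ∈ F) :
    ∃ i < t, e i = f := by
  rw [← h.image_eq] at hf
  simpa using hf

lemma EdgePath.card_eq (h : EdgePath F t c e) : F.card = t := by
  rw [← h.image_eq, Finset.card_image_of_injOn, Finset.card_range]
  intro i hi j hj hij
  exact h.edges_inj i j (by simpa using hi) (by simpa using hj) hij

lemma EdgePath.card_connectors (h : EdgePath F t c e) : (connectors t c).card = t - 1 := by
  rw [connectors, Finset.card_image_of_injOn, Nat.card_Ico]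
  intro i hi j hj hij
  simp only [Finset.coe_Ico, Set.mem_Ico] at hi hj
  exact h.conn_inj i j hi.1 hi.2 hj.1 hj.2 hij

lemma EdgePath.rotate (h : EdgePath F t c e) {j : ℕ} {u : V} (hjt : j < t)
    (hu0 : u ∈ e 0) (huj : u ∈ e j) (hu : ∀ i, 1 ≤ i → i < t → i ≠ j → c i ≠ u) :
    EdgePath F t (rotConn j u c) (rotEdge j e) where
  image_eq := by
    rw [← h.image_eq]
    ext f
    simp only [Finset.mem_image, Finset.mem_range, rotEdge]
    constructor
    · rintro ⟨i, hi, rfl⟩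
      split_ifs
      · exact ⟨j - 1 - i, by omega, rfl⟩
      · exact ⟨i, hi, rfl⟩
    · rintro ⟨i, hi, rfl⟩
      by_cases hij : i < j
      · exact ⟨j - 1 - i, by omega, by rw [if_pos (by omega)]; congr 1; omega⟩
      · exact ⟨i, hi, by rw [if_neg hij]⟩
  edges_inj := by
    intro a b ha hb hab
    simp only [rotEdge] at hab
    split_ifs at hab
    all_goals
      have := h.edges_inj _ _ (by omega) (by omega) hab
      omega
  conn_inj := by
    intro a b ha hat hb hbt hab
    have inj := h.conn_inj
    simp only [rotConn] at hab
    split_ifs at hab <;> try omega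
    all_goals first
      | (have := inj _ _ (by omega) (by omega) (by omega) (by omega) hab; omega)
      | exact absurd hab (hu _ (by omega) (by omega) (by omega))
      | exact absurd hab.symm (hu _ (by omega) (by omega) (by omega))
  left := by
    intro i hi
    simp only [rotConn, rotEdge]
    split_ifs <;> try omega
    · have := h.right (j - 1 - i - 1) (by omega)
      rwa [show j - 1 - i - 1 + 1 = j - 1 - i by omega,
        show c (j - 1 - i) = c (j - (i + 1)) by congr 1; omega] at this
    · rwa [show j - 1 - i = 0 by omega]
    · exact h.left i hi
  right := by
    intro i hi
    simp only [rotConn, rotEdge]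
    split_ifs with h1 h2 <;> try omega
    · have := h.left (j - 1 - (i + 1)) (by omega)
      rwa [show j - 1 - (i + 1) + 1 = j - (i + 1) by omega] at this
    · rwa [h2]
    · exact h.right i hi

lemma EdgePath.cons (h : EdgePath F t c e) {f : Finset V} (hf : f ∉ F) {x : V} (hxf : x ∈ f)
    (hx0 : x ∈ e 0) (hx : x ∉ connectors t c) :
    EdgePath (insert f F) (t + 1) (fun i => if i = 1 then x else c (i - 1))
      (fun i => if i = 0 then f else e (i - 1)) where
  image_eq := by
    rw [← h.image_eq]
    ext g
    simp only [Finset.mem_image, Finset.mem_range, Finset.mem_insert]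
    constructor
    · rintro ⟨_ | i, hi, rfl⟩
      · simp
      · exact Or.inr ⟨i, by omega, by simp⟩
    · rintro (rfl | ⟨i, hi, rfl⟩)
      · exact ⟨0, by omega, by simp⟩
      · exact ⟨i + 1, by omega, by simp⟩
  edges_inj := by
    have hne : ∀ i < t, e i ≠ f := fun i hi hif => hf (hif ▸ h.mem hi)
    intro i j hi hj hij
    split_ifs at hij <;> try omega
    · exact absurd hij.symm (hne _ (by omega))
    · exact absurd hij (hne _ (by omega))
    · have := h.edges_inj _ _ (by omega) (by omega) hij
      omega
  conn_inj := by
    have hne : ∀ i, 1 ≤ i → i < t → c i ≠ x :=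
      fun i h1 hi hix => hx (mem_connectors.2 ⟨i, h1, hi, hix⟩)
    intro i j hi hit hj hjt hij
    split_ifs at hij <;> try omega
    · exact absurd hij.symm (hne _ (by omega) (by omega))
    · exact absurd hij (hne _ (by omega) (by omega))
    · have := h.conn_inj _ _ (by omega) (by omega) (by omega) (by omega) hij
      omega
  left := by
    rintro (_ | i) hi
    · simpa using hxf
    · simpa using h.left i (by omega)
  right := by
    rintro (_ | i) hi
    · simpa using hx0
    · simpa using h.right i (by omega)

lemma EdgePath.mem_of_free (h : EdgePath F t c e) (hFH : F ⊆ H) (hno : NoEdgePath H (t + 1))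
    {x : V} (hx0 : x ∈ e 0) (hx : x ∉ connectors t c) {f : Finset V} (hf : f ∈ H) (hxf : x ∈ f) :
    f ∈ F := by
  by_contra hfF
  exact hno _ (Finset.insert_subset hf hFH) _ _ (h.cons hfF hxf hx0 hx)

lemma rotEdge_last {j : ℕ} (hjt : j < t) : rotEdge j e (t - 1) = e (t - 1) := by
  rw [rotEdge, if_neg (by omega)]

lemma rotEdge_zero {j : ℕ} (hj : 1 ≤ j) : rotEdge j e 0 = e (j - 1) := by
  rw [rotEdge, if_pos (by omega), Nat.sub_zero]

lemma mem_connectors_rotConn {j : ℕ} {u : V} (hj : 1 ≤ j) (hjt : j < t) {x : V} :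
    x ∈ connectors t (rotConn j u c) ↔ x = u ∨ ∃ i, 1 ≤ i ∧ i < t ∧ i ≠ j ∧ c i = x := by
  simp only [mem_connectors, rotConn]
  constructor
  · rintro ⟨i, h1, hi, hx⟩
    split_ifs at hx
    · exact Or.inr ⟨j - i, by omega, by omega, by omega, hx⟩
    · exact Or.inl hx.symm
    · exact Or.inr ⟨i, h1, hi, by omega, hx⟩
  · rintro (rfl | ⟨i, h1, hi, hij, hx⟩)
    · exact ⟨j, hj, hjt, by simp⟩
    · by_cases hlt : i < j
      · exact ⟨j - i, by omega, by omega, by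
          rw [if_pos (by omega), show j - (j - i) = i by omega, hx]⟩
      · exact ⟨i, h1, hi, by rw [if_neg hlt, if_neg hij, hx]⟩

lemma connectors_rotConn_self {j : ℕ} (hj : 1 ≤ j) (hjt : j < t) :
    connectors t (rotConn j (c j) c) = connectors t c := by
  ext x
  rw [mem_connectors_rotConn hj hjt, mem_connectors]
  constructor
  · rintro (rfl | ⟨i, h1, hi, -, hx⟩)
    exacts [⟨j, hj, hjt, rfl⟩, ⟨i, h1, hi, hx⟩]
  · rintro ⟨i, h1, hi, rfl⟩
    by_cases hij : i = j
    · exact Or.inl (by rw [hij])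
    · exact Or.inr ⟨i, h1, hi, hij, rfl⟩

lemma EdgePath.rotate_self (h : EdgePath F t c e) {j : ℕ} (hj : 1 ≤ j) (hjt : j < t)
    (hc : c j ∈ e 0) : EdgePath F t (rotConn j (c j) c) (rotEdge j e) := by
  refine h.rotate hjt hc ?_ fun i h1 hi hij hc' => hij (h.conn_inj i j h1 hi hj hjt hc')
  have := h.right (j - 1) (by omega)
  rwa [Nat.sub_add_cancel hj] at this

lemma EdgePath.rotate_free (h : EdgePath F t c e) {j : ℕ} {u : V} (hjt : j < t)
    (hu0 : u ∈ e 0) (hu : u ∉ connectors t c) (huj : u ∈ e j) :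
    EdgePath F t (rotConn j u c) (rotEdge j e) :=
  h.rotate hjt hu0 huj fun i h1 hi _ hc => hu (mem_connectors.2 ⟨i, h1, hi, hc⟩)

lemma EdgePath.two_le_card_sdiff (h : EdgePath F t c e) (hF : ∀ f ∈ F, f.card = r) (htr : t < r)
    {f : Finset V} (hf : f ∈ F) : 2 ≤ (f \ connectors t c).card := by
  have h1 := Finset.le_card_sdiff (connectors t c) f
  rw [hF f hf, h.card_connectors] at h1
  have : 0 < t := h.card_eq ▸ Finset.card_pos.2 ⟨f, hf⟩
  omega

variable [Fintype V]

lemma EdgePath.sdiff_subset_freeEnds (h : EdgePath F t c e) :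
    e 0 \ connectors t c ⊆ freeEnds F (e (t - 1)) t := by
  intro x hx
  exact Finset.mem_filter.2 ⟨Finset.mem_univ _, c, e, h, rfl, hx⟩

lemma EdgePath.conn_mem_freeEnds (h : EdgePath F t c e) {j : ℕ} {u : V} (hj : 1 ≤ j) (hjt : j < t)
    (hu0 : u ∈ e 0) (hu : u ∉ connectors t c) (huj : u ∈ e j) :
    c j ∈ freeEnds F (e (t - 1)) t := by
  have h' := (h.rotate_free hjt hu0 hu huj).sdiff_subset_freeEnds
  rw [rotEdge_last hjt, rotEdge_zero hj] at h'
  apply h'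
  rw [Finset.mem_sdiff, mem_connectors_rotConn hj hjt]
  refine ⟨?_, ?_⟩
  · have := h.left (j - 1) (by omega)
    rwa [Nat.sub_add_cancel hj] at this
  · rintro (hx | ⟨i, h1, hi, hij, hx⟩)
    · exact hu (mem_connectors.2 ⟨j, hj, hjt, hx⟩)
    · exact hij (h.conn_inj i j h1 hi hj hjt hx)

lemma EdgePath.sdiff_pred_subset_freeEnds (h : EdgePath F t c e) {j : ℕ} (hj : 1 ≤ j) (hjt : j < t)
    (hc : c j ∈ e 0) : e (j - 1) \ connectors t c ⊆ freeEnds F (e (t - 1)) t := by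
  have h' := (h.rotate_self hj hjt hc).sdiff_subset_freeEnds
  rwa [rotEdge_last hjt, rotEdge_zero hj, connectors_rotConn_self hj hjt] at h'

/-- If `c l` and `c j` both lie in the first edge, `l < j`, and the edges preceding them share a free
vertex, then the connector before `c j` is a free end. -/
lemma EdgePath.conn_pred_mem_freeEnds (h : EdgePath F t c e) {l j : ℕ} {u : V} (hl : 1 ≤ l)
    (hlj : l < j) (hjt : j < t) (hcl : c l ∈ e 0) (hu : u ∉ connectors t c)
    (hul : u ∈ e (l - 1)) (huj : u ∈ e (j - 1)) : c (j - 1) ∈ freeEnds F (e (t - 1)) t := by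
  have hlt : l < t := by omega
  have h' := (h.rotate_self hl hlt hcl).conn_mem_freeEnds (j := j - 1) (u := u) (by omega)
    (by omega) (by rwa [rotEdge_zero hl]) (by rwa [connectors_rotConn_self hl hlt])
    (by rwa [rotEdge, if_neg (by omega)])
  rw [rotEdge_last hlt, rotConn, if_neg (by omega)] at h'
  split_ifs at h' with hjl
  · rwa [hjl]
  · exact h'

/-- When there are few free ends, they are determined by any single arrangement of the edges. -/
lemma EdgePath.freeEnds_eq_of_card_lt (h : EdgePath F t c e) (hF : ∀ f ∈ F, f.card = r)
    (htr : t < r) (ht : 2 ≤ t) (hX : (freeEnds F (e (t - 1)) t).card < r) :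
    freeEnds F (e (t - 1)) t \ connectors t c = e 0 \ connectors t c ∧
      freeEnds F (e (t - 1)) t ∩ connectors t c =
        ((Finset.Ico 2 t).filter fun j => c j ∈ e 0).image fun j => c (j - 1) := by
  set X := freeEnds F (e (t - 1)) t with hXdef
  set Q := connectors t c with hQ
  set B := (Finset.Ico 2 t).filter fun j => c j ∈ e 0 with hB
  have hBmem : ∀ {j}, j ∈ B ↔ (2 ≤ j ∧ j < t) ∧ c j ∈ e 0 := by simp [hB]
  have hc1 : c 1 ∈ e 0 := h.left 0 (by omega)
  have hcard0 : (e 0 \ Q).card + B.card + 1 = r := by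
    have hinter : e 0 ∩ Q = (insert 1 B).image c := by
      ext x
      simp only [Finset.mem_inter, hQ, mem_connectors, Finset.mem_image, Finset.mem_insert, hBmem]
      constructor
      · rintro ⟨hx, i, h1, hi, rfl⟩
        exact ⟨i, by by_cases i = 1 <;> simp_all; omega, rfl⟩
      · rintro ⟨i, rfl | ⟨⟨h2, hi⟩, hx⟩, rfl⟩
        · exact ⟨hc1, 1, le_rfl, by omega, rfl⟩
        · exact ⟨hx, i, by omega, hi, rfl⟩
    have h1 := Finset.card_sdiff_add_card_inter (e 0) Q
    rw [hinter, Finset.card_image_of_injOn, Finset.card_insert_of_notMem, hF _ (h.mem (by omega))]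
      at h1
    · omega
    · simp [hBmem]
    · intro i hi j hj hij
      simp only [Finset.coe_insert, Set.mem_insert_iff, Finset.mem_coe, hBmem] at hi hj
      exact h.conn_inj i j (by omega) (by omega) (by omega) (by omega) hij
  set D := B.filter fun j => c (j - 1) ∉ X with hD
  set G := B.filter fun j => c (j - 1) ∈ X with hG
  have hDG : G.card + D.card = B.card := Finset.card_filter_add_card_filter_not _
  set U := D.biUnion fun j => e (j - 1) \ Q with hU
  have hUcard : 2 * D.card ≤ U.card := by
    rw [hU, Finset.card_biUnion, mul_comm, ← smul_eq_mul]
    · refine Finset.card_nsmul_le_sum _ _ _ fun j hj => ?_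
      have hj := hBmem.1 (Finset.mem_filter.1 hj).1
      exact h.two_le_card_sdiff hF htr (h.mem (by omega))
    · have key : ∀ i ∈ D, ∀ j ∈ D, i < j → Disjoint (e (i - 1) \ Q) (e (j - 1) \ Q) := by
        intro i hi j hj hij
        rw [Finset.disjoint_left]
        intro x hxi hxj
        rw [Finset.mem_sdiff] at hxi hxj
        have hi' := hBmem.1 (Finset.mem_filter.1 hi).1
        have hj' := hBmem.1 (Finset.mem_filter.1 hj).1
        exact (Finset.mem_filter.1 hj).2
          (h.conn_pred_mem_freeEnds (by omega) hij hj'.1.2 hi'.2 hxi.2 hxi.1 hxj.1)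
      intro i hi j hj hij
      rcases lt_or_gt_of_ne hij with hlt | hlt
      · exact key i hi j hj hlt
      · exact (key j hj i hi hlt).symm
  have hdisj : Disjoint (e 0 \ Q) U := by
    rw [hU, Finset.disjoint_biUnion_right]
    intro j hj
    rw [Finset.disjoint_left]
    intro x hx0 hxj
    rw [Finset.mem_sdiff] at hx0 hxj
    have hj' := hBmem.1 (Finset.mem_filter.1 hj).1
    exact (Finset.mem_filter.1 hj).2
      (h.conn_pred_mem_freeEnds le_rfl (by omega) hj'.1.2 hc1 hx0.2 hx0.1 hxj.1)
  have hsub0 : e 0 \ Q ⊆ X \ Q := fun x hx =>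
    Finset.mem_sdiff.2 ⟨h.sdiff_subset_freeEnds hx, (Finset.mem_sdiff.1 hx).2⟩
  have hsubU : e 0 \ Q ∪ U ⊆ X \ Q := by
    refine Finset.union_subset hsub0 (Finset.biUnion_subset.2 fun j hj x hx => ?_)
    have hj' := hBmem.1 (Finset.mem_filter.1 hj).1
    exact Finset.mem_sdiff.2
      ⟨h.sdiff_pred_subset_freeEnds (by omega) hj'.1.2 hj'.2 hx, (Finset.mem_sdiff.1 hx).2⟩
  have hsubG : G.image (fun j => c (j - 1)) ⊆ X ∩ Q := by
    intro x hx
    obtain ⟨j, hj, rfl⟩ := Finset.mem_image.1 hx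
    have hj' := hBmem.1 (Finset.mem_filter.1 hj).1
    exact Finset.mem_inter.2 ⟨(Finset.mem_filter.1 hj).2,
      mem_connectors.2 ⟨j - 1, by omega, by omega, rfl⟩⟩
  have hGcard : (G.image fun j => c (j - 1)).card = G.card := by
    refine Finset.card_image_of_injOn fun i hi j hj hij => ?_
    have hi' := hBmem.1 (Finset.mem_filter.1 hi).1
    have hj' := hBmem.1 (Finset.mem_filter.1 hj).1
    have := h.conn_inj (i - 1) (j - 1) (by omega) (by omega) (by omega) (by omega) hij
    omega
  have h1 := Finset.card_le_card hsubU
  rw [Finset.card_union_of_disjoint hdisj] at h1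
  have h2 := Finset.card_le_card hsubG
  rw [hGcard] at h2
  have h3 := Finset.card_sdiff_add_card_inter X Q
  have hD0 : D = ∅ := Finset.card_eq_zero.1 (by omega)
  have hGB : G = B := by
    refine Finset.filter_true_of_mem fun j hj => ?_
    by_contra hjX
    exact Finset.notMem_empty j (hD0 ▸ Finset.mem_filter.2 ⟨hj, hjX⟩)
  refine ⟨(Finset.eq_of_subset_of_card_le hsub0 (by omega)).symm, ?_⟩
  rw [← hGB]
  exact (Finset.eq_of_subset_of_card_le hsubG (by omega)).symm

/-- When there are few free ends, they are the free vertices of a leaf edge. -/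
lemma EdgePath.freeEnds_inter_connectors_eq_empty (h : EdgePath F t c e)
    (hF : ∀ f ∈ F, f.card = r) (htr : t < r) (ht : 2 ≤ t)
    (hX : (freeEnds F (e (t - 1)) t).card < r) :
    freeEnds F (e (t - 1)) t ∩ connectors t c = ∅ := by
  obtain ⟨hsd, hint⟩ := h.freeEnds_eq_of_card_lt hF htr ht hX
  set X := freeEnds F (e (t - 1)) t with hXdef
  have next : ∀ m, 1 ≤ m → m < t → c m ∈ X → m + 1 < t ∧ c (m + 1) ∈ e 0 := by
    intro m hm hmt hmX
    have hmem : c m ∈ X ∩ connectors t c :=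
      Finset.mem_inter.2 ⟨hmX, mem_connectors.2 ⟨m, hm, hmt, rfl⟩⟩
    rw [hint, Finset.mem_image] at hmem
    obtain ⟨j, hj, hjm⟩ := hmem
    simp only [Finset.mem_filter, Finset.mem_Ico] at hj
    have := h.conn_inj (j - 1) m (by omega) (by omega) hm hmt hjm
    obtain rfl : j = m + 1 := by omega
    exact ⟨hj.1.2, hj.2⟩
  have prev : ∀ j, 2 ≤ j → j < t → c j ∈ e 0 → c (j - 1) ∈ X := by
    intro j hj hjt hc
    have : c (j - 1) ∈ X ∩ connectors t c := by
      rw [hint]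
      exact Finset.mem_image.2 ⟨j, by simp [hj, hjt, hc], rfl⟩
    exact (Finset.mem_inter.1 this).1
  have down : ∀ m, 1 ≤ m → m < t → c m ∈ X → c 1 ∈ X := by
    intro m hm
    induction m, hm using Nat.le_induction with
    | base => exact fun _ h1 => h1
    | succ m hm ih =>
      intro hmt hmX
      refine ih (by omega) ?_
      obtain ⟨hm2, hc⟩ := next (m + 1) (by omega) hmt hmX
      have hsub := h.sdiff_pred_subset_freeEnds (j := m + 1 + 1) (by omega) hm2 hc
      rw [Nat.add_sub_cancel] at hsub
      have hem := h.two_le_card_sdiff hF htr (h.mem hmt)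
      obtain ⟨u, hu⟩ := Finset.card_pos.1 (by omega : 0 < (e (m + 1) \ connectors t c).card)
      have hu' : u ∈ X \ connectors t c :=
        Finset.mem_sdiff.2 ⟨hsub hu, (Finset.mem_sdiff.1 hu).2⟩
      rw [hsd, Finset.mem_sdiff] at hu'
      have hrot := h.rotate_free (j := m + 1) hmt hu'.1 hu'.2 (Finset.mem_sdiff.1 hu).1
      have hlast : rotEdge (m + 1) e (t - 1) = e (t - 1) := rotEdge_last hmt
      have hsd' := (hrot.freeEnds_eq_of_card_lt hF htr ht (by rwa [hlast])).1
      rw [hlast, ← hXdef, rotEdge_zero (by omega), Nat.add_sub_cancel] at hsd'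
      have he0 := h.two_le_card_sdiff hF htr (h.mem (by omega : 0 < t))
      obtain ⟨w, hw, hwu⟩ := Finset.exists_mem_ne (by omega : 1 < (e 0 \ connectors t c).card) u
      have hwX := h.sdiff_subset_freeEnds hw
      rw [Finset.mem_sdiff] at hw
      have hwm : w ∈ X \ connectors t (rotConn (m + 1) u c) := by
        rw [Finset.mem_sdiff, mem_connectors_rotConn (by omega) hmt]
        refine ⟨hwX, ?_⟩
        rintro (hwu' | ⟨i, h1, hi, -, hiw⟩)
        · exact hwu hwu'
        · exact hw.2 (mem_connectors.2 ⟨i, h1, hi, hiw⟩)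
      rw [hsd', Finset.mem_sdiff] at hwm
      exact h.conn_mem_freeEnds hm (by omega) hw.1 hw.2 hwm.1
  rw [Finset.eq_empty_iff_forall_notMem]
  intro x hx
  obtain ⟨hxX, hxQ⟩ := Finset.mem_inter.1 hx
  obtain ⟨m, hm, hmt, rfl⟩ := mem_connectors.1 hxQ
  have h1X := down m hm hmt hxX
  obtain ⟨h2t, hc2⟩ := next 1 le_rfl (by omega) h1X
  have hrot := h.rotate_self (j := 2) (by omega) h2t hc2
  have hlast : rotEdge 2 e (t - 1) = e (t - 1) := rotEdge_last h2t
  obtain ⟨hsd', hint'⟩ := hrot.freeEnds_eq_of_card_lt hF htr ht (by rwa [hlast])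
  rw [hlast, ← hXdef, rotEdge_zero (by omega), connectors_rotConn_self (by omega) h2t] at hsd' hint'
  have hconn : ∀ i, 1 ≤ i → rotConn 2 (c 2) c i = c i := by
    rintro (_ | _ | _ | i) hi <;> simp_all [rotConn]
  have hsub : ∀ x ∈ e 0, x ∈ e 1 := by
    intro x hx
    by_cases hxQ : x ∈ connectors t c
    · obtain ⟨j, hj, hjt, rfl⟩ := mem_connectors.1 hxQ
      rcases Nat.lt_or_ge j 2 with hj2 | hj2
      · obtain rfl : j = 1 := by omega
        exact h.right 0 (by omega)
      · have hmem : c (j - 1) ∈ X ∩ connectors t c :=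
          Finset.mem_inter.2 ⟨prev j hj2 hjt hx, mem_connectors.2 ⟨j - 1, by omega, by omega, rfl⟩⟩
        rw [hint', Finset.mem_image] at hmem
        obtain ⟨i, hi, hij⟩ := hmem
        simp only [Finset.mem_filter, Finset.mem_Ico] at hi
        rw [hconn _ (by omega)] at hi hij
        have := h.conn_inj (i - 1) (j - 1) (by omega) (by omega) (by omega) (by omega) hij
        obtain rfl : i = j := by omega
        exact hi.2
    · have : x ∈ e 0 \ connectors t c := Finset.mem_sdiff.2 ⟨hx, hxQ⟩
      rw [← hsd, hsd'] at this
      exact (Finset.mem_sdiff.1 this).1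
  have heq : e 0 = e 1 := Finset.eq_of_subset_of_card_le hsub
    (by rw [hF _ (h.mem (by omega : 0 < t)), hF _ (h.mem (by omega : 1 < t))])
  have := h.edges_inj 0 1 (by omega) (by omega) heq
  omega

lemma mem_erase_of_mem_freeEnds {l : Finset V} (hFH : F ⊆ H)
    (hno : NoEdgePath H (t + 1)) (hcyc : NoEdgeCycle H t) {x : V} (hx : x ∈ freeEnds F l t)
    {f : Finset V} (hf : f ∈ H) (hxf : x ∈ f) : f ∈ F.erase l := by
  obtain ⟨-, c, e, h, rfl, hxe⟩ := Finset.mem_filter.1 hx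
  obtain ⟨hx0, hxc⟩ := Finset.mem_sdiff.1 hxe
  refine Finset.mem_erase.2 ⟨?_, h.mem_of_free hFH hno hx0 hxc hf hxf⟩
  rintro rfl
  exact hxc (hcyc F hFH c e h x hx0 hxf)

/-- A longest edge path that does not close up yields a set of vertices meeting few edges. -/
lemma EdgePath.exists_sparse_set (h : EdgePath F t c e) (hFH : F ⊆ H)
    (hH : ∀ f ∈ H, f.card = r) (htr : t < r) (ht : 2 ≤ t) (hno : NoEdgePath H (t + 1))
    (hcyc : NoEdgeCycle H t) :
    ∃ X : Finset V, X ⊆ H.biUnion id ∧ X.Nonempty ∧ (∃ v ∈ H.biUnion id, v ∉ X) ∧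
      (r + 1) * (H.filter fun f => ¬ Disjoint f X).card ≤ t * X.card := by
  have hF : ∀ f ∈ F, f.card = r := fun f hf => hH f (hFH hf)
  set X := freeEnds F (e (t - 1)) t with hXdef
  have hmeet : ∀ f ∈ H.filter fun f => ¬ Disjoint f X, f ∈ F.erase (e (t - 1)) := by
    intro f hf
    obtain ⟨hfH, hfX⟩ := Finset.mem_filter.1 hf
    obtain ⟨x, hxf, hxX⟩ := Finset.not_disjoint_iff.1 hfX
    exact mem_erase_of_mem_freeEnds hFH hno hcyc hxX hfH hxf
  have h0X : e 0 \ connectors t c ⊆ X := h.sdiff_subset_freeEnds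
  have h0card := h.two_le_card_sdiff hF htr (h.mem (by omega : 0 < t))
  have hlast : e (t - 1) ∈ F := h.mem (by omega)
  refine ⟨X, ?_, ?_, ?_, ?_⟩
  · intro x hx
    obtain ⟨-, c', e', h', -, hx⟩ := Finset.mem_filter.1 hx
    exact Finset.mem_biUnion.2 ⟨e' 0, hFH (h'.mem (by omega)), (Finset.mem_sdiff.1 hx).1⟩
  · exact Finset.Nonempty.mono h0X (Finset.card_pos.1 (by omega))
  · obtain ⟨v, hv⟩ := Finset.card_pos.1 (by rw [hF _ hlast]; omega : 0 < (e (t - 1)).card)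
    refine ⟨v, Finset.mem_biUnion.2 ⟨_, hFH hlast, hv⟩, fun hvX => ?_⟩
    exact Finset.notMem_erase _ _ (hmeet _ (Finset.mem_filter.2
      ⟨hFH hlast, Finset.not_disjoint_iff.2 ⟨v, hv, hvX⟩⟩))
  · rcases Nat.lt_or_ge X.card r with hXr | hXr
    · have hemp := h.freeEnds_inter_connectors_eq_empty hF htr ht hXr
      obtain ⟨hsd, hint⟩ := h.freeEnds_eq_of_card_lt hF htr ht hXr
      rw [← hXdef] at hemp hsd hint
      have hXeq : X = e 0 \ connectors t c := by
        rw [← hsd, eq_comm, Finset.sdiff_eq_self_iff_disjoint, Finset.disjoint_iff_inter_eq_empty, hemp]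
      have hinter : e 0 ∩ connectors t c ⊆ {c 1} := by
        intro x hx
        obtain ⟨hx0, hxQ⟩ := Finset.mem_inter.1 hx
        obtain ⟨j, hj, hjt, rfl⟩ := mem_connectors.1 hxQ
        by_contra hj1
        have hj2 : 2 ≤ j := by
          by_contra hlt
          obtain rfl : j = 1 := by omega
          exact hj1 (Finset.mem_singleton_self _)
        have : c (j - 1) ∈ X ∩ connectors t c := by
          rw [hint]
          exact Finset.mem_image.2 ⟨j, by simp [hj2, hjt, hx0], rfl⟩
        rw [hemp] at this
        exact Finset.notMem_empty _ this
      have hXcard : r ≤ X.card + 1 := by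
        have h1 := Finset.card_sdiff_add_card_inter (e 0) (connectors t c)
        have h2 := Finset.card_le_card hinter
        rw [hF _ (h.mem (by omega : 0 < t)), ← hXeq] at h1
        rw [Finset.card_singleton] at h2
        omega
      have hone : (H.filter fun f => ¬ Disjoint f X) ⊆ {e 0} := by
        intro f hf
        obtain ⟨j, hjt, rfl⟩ := h.exists_of_mem (Finset.mem_of_mem_erase (hmeet f hf))
        obtain ⟨x, hxf, hxX⟩ := Finset.not_disjoint_iff.1 (Finset.mem_filter.1 hf).2
        rw [hXeq, Finset.mem_sdiff] at hxX
        rcases Nat.eq_zero_or_pos j with rfl | hj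
        · exact Finset.mem_singleton_self _
        · have : c j ∈ X ∩ connectors t c := Finset.mem_inter.2
            ⟨h.conn_mem_freeEnds hj hjt hxX.1 hxX.2 hxf, mem_connectors.2 ⟨j, hj, hjt, rfl⟩⟩
          rw [hemp] at this
          exact absurd this (Finset.notMem_empty _)
      have h1 := Finset.card_le_card hone
      rw [Finset.card_singleton] at h1
      calc (r + 1) * (H.filter fun f => ¬ Disjoint f X).card ≤ (r + 1) * 1 := by gcongr
        _ ≤ 2 * X.card := by omega
        _ ≤ t * X.card := by gcongr
    · have h1 := Finset.card_le_card (show (H.filter fun f => ¬ Disjoint f X) ⊆ _ from hmeet)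
      rw [Finset.card_erase_of_mem hlast, h.card_eq] at h1
      obtain ⟨s, rfl⟩ : ∃ s, t = s + 1 := ⟨t - 1, by omega⟩
      calc (r + 1) * (H.filter fun f => ¬ Disjoint f X).card ≤ (r + 1) * s := by gcongr; omega
        _ ≤ (s + 1) * r := by nlinarith
        _ ≤ (s + 1) * X.card := by gcongr

end EdgePath

section Cycle

variable {V : Type*} {F H : Finset (Finset V)} {t r k : ℕ} {c : ℕ → V} {e : ℕ → Finset V}

lemma EdgePath.cycle_shift (h : EdgePath F t c e) (ht : 2 ≤ t) {x : V} (hx0 : x ∈ e 0)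
    (hxl : x ∈ e (t - 1)) (hx : x ∉ connectors t c) :
    EdgePath F t (fun i => if i = t - 1 then x else c (i + 1))
      (fun i => if i = t - 1 then e 0 else e (i + 1)) where
  image_eq := by
    rw [← h.image_eq]
    ext g
    simp only [Finset.mem_image, Finset.mem_range]
    constructor
    · rintro ⟨i, hi, rfl⟩
      split_ifs
      · exact ⟨0, by omega, rfl⟩
      · exact ⟨i + 1, by omega, rfl⟩
    · rintro ⟨_ | i, hi, rfl⟩
      · exact ⟨t - 1, by omega, if_pos rfl⟩
      · exact ⟨i, by omega, if_neg (by omega)⟩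
  edges_inj := by
    intro i j hi hj hij
    split_ifs at hij
    · omega
    all_goals
      have := h.edges_inj _ _ (by omega) (by omega) hij
      omega
  conn_inj := by
    have hne : ∀ i, 1 ≤ i → i < t → c i ≠ x :=
      fun i h1 hi hix => hx (mem_connectors.2 ⟨i, h1, hi, hix⟩)
    intro i j hi hit hj hjt hij
    split_ifs at hij
    · omega
    · exact absurd hij.symm (hne _ (by omega) (by omega))
    · exact absurd hij (hne _ (by omega) (by omega))
    · have := h.conn_inj _ _ (by omega) (by omega) (by omega) (by omega) hij
      omega
  left := by
    intro i hi
    split_ifs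
    · omega
    · omega
    · rwa [show i + 1 = t - 1 by omega]
    · exact h.left (i + 1) (by omega)
  right := by
    intro i hi
    split_ifs
    · exact hx0
    · exact h.right (i + 1) (by omega)

lemma EdgePath.cycle_rotate (h : EdgePath F t c e) {x : V} (hx0 : x ∈ e 0)
    (hxl : x ∈ e (t - 1)) (hx : x ∉ connectors t c) {j : ℕ} (hjt : j < t) :
    ∃ c' e' x', EdgePath F t c' e' ∧ x' ∈ e' 0 ∧ x' ∈ e' (t - 1) ∧ x' ∉ connectors t c' ∧
      (∀ i, j + i < t → e' i = e (j + i)) ∧ (∀ i, 1 ≤ i → j + i < t → c' i = c (j + i)) ∧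
      (1 ≤ j → x' = c j) := by
  induction j with
  | zero => exact ⟨c, e, x, h, hx0, hxl, hx, by simp, by simp, by simp⟩
  | succ j ih =>
    obtain ⟨c', e', x', h', hx0', hxl', hx', he, hc, -⟩ := ih (by omega)
    refine ⟨_, _, c' 1, h'.cycle_shift (by omega) hx0' hxl' hx', ?_, ?_, ?_, ?_, ?_, ?_⟩
    · rw [if_neg (by omega)]
      exact h'.right 0 (by omega)
    · rw [if_pos rfl]
      exact h'.left 0 (by omega)
    · intro hmem
      obtain ⟨i, h1, hi, hci⟩ := mem_connectors.1 hmem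
      split_ifs at hci
      · exact hx' (mem_connectors.2 ⟨1, le_rfl, by omega, hci.symm⟩)
      · have := h'.conn_inj _ _ (by omega) (by omega) le_rfl (by omega) hci
        omega
    · intro i hi
      rw [if_neg (by omega), he (i + 1) (by omega)]
      congr 1
      omega
    · intro i h1 hi
      rw [if_neg (by omega), hc (i + 1) (by omega) (by omega)]
      congr 1
      omega
    · exact fun _ => hc 1 le_rfl hjt

/-- The edges of a cycle with no longer edge path around form a whole component. -/
lemma EdgePath.mem_of_meets_cycle (h : EdgePath F t c e) (hFH : F ⊆ H)
    (hno : NoEdgePath H (t + 1)) {x : V} (hx0 : x ∈ e 0) (hxl : x ∈ e (t - 1))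
    (hx : x ∉ connectors t c) {f : Finset V} (hf : f ∈ H) (hfF : ¬ Disjoint f (F.biUnion id)) :
    f ∈ F := by
  obtain ⟨y, hyf, hyF⟩ := Finset.not_disjoint_iff.1 hfF
  obtain ⟨g, hg, hyg⟩ := Finset.mem_biUnion.1 hyF
  obtain ⟨j, hjt, rfl⟩ := h.exists_of_mem hg
  obtain ⟨c', e', x', h', hx0', hxl', hx', he, -, -⟩ := h.cycle_rotate hx0 hxl hx hjt
  have hy0 : y ∈ e' 0 := by
    rw [he 0 (by omega)]
    exact hyg
  by_cases hy : y ∈ connectors t c'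
  · obtain ⟨i, hi, hit, rfl⟩ := mem_connectors.1 hy
    obtain ⟨c'', e'', x'', h'', hx0'', -, hx'', -, -, hxc⟩ := h'.cycle_rotate hx0' hxl' hx' hit
    obtain rfl := hxc hi
    exact h''.mem_of_free hFH hno hx0'' hx'' hf hyf
  · exact h'.mem_of_free hFH hno hy0 hy hf hyf

end Cycle

section Counting

variable {V : Type*} {F H H' : Finset (Finset V)} {S : Finset V} {t r k : ℕ} {c : ℕ → V}
  {e : ℕ → Finset V}

lemma NoEdgePath.mono (h : NoEdgePath H k) (hH : H' ⊆ H) : NoEdgePath H' k :=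
  fun F hF => h F (hF.trans hH)

lemma NoEdgeCycle.mono (h : NoEdgeCycle H k) (hH : H' ⊆ H) : NoEdgeCycle H' k :=
  fun F hF => h F (hF.trans hH)

lemma subset_sdiff_of_mem_filter {X : Finset V} (hS : ∀ f ∈ H, f ⊆ S) :
    ∀ f ∈ H.filter fun f => Disjoint f X, f ⊆ S \ X := fun f hf =>
  Finset.subset_sdiff.2 ⟨hS f (Finset.mem_filter.1 hf).1, (Finset.mem_filter.1 hf).2⟩

lemma EdgePath.le_card_biUnion (h : EdgePath F t c e) (ht : 1 ≤ t) (hF : ∀ f ∈ F, f.card = r) :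
    r ≤ (F.biUnion id).card := by
  have h0 : e 0 ∈ F := h.mem (by omega)
  rw [← hF _ h0]
  exact Finset.card_le_card (Finset.subset_biUnion_of_mem id h0)

lemma EdgePath.succ_le_card_biUnion (h : EdgePath F t c e) (ht : 2 ≤ t)
    (hF : ∀ f ∈ F, f.card = r) : r + 1 ≤ (F.biUnion id).card := by
  by_contra hlt
  have hall : ∀ i < t, e i = F.biUnion id := fun i hi =>
    Finset.eq_of_subset_of_card_le (Finset.subset_biUnion_of_mem id (h.mem hi))
      (by rw [hF _ (h.mem hi)]; omega)
  have := h.edges_inj 0 1 (by omega) (by omega) ((hall 0 (by omega)).trans (hall 1 (by omega)).symm)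
  omega

lemma exists_longest_edgePath [Nonempty V] (hk : 1 < k) (hne : H.Nonempty) (hno : NoEdgePath H k) :
    ∃ t, 1 ≤ t ∧ t < k ∧ NoEdgePath H (t + 1) ∧ ∃ F ⊆ H, ∃ c e, EdgePath F t c e := by
  have hex : ∃ s, NoEdgePath H (s + 2) := ⟨k - 2, by rwa [Nat.sub_add_cancel hk]⟩
  have hmin := fun s => Nat.find_min hex (m := s)
  have hle : Nat.find hex ≤ k - 2 := Nat.find_min' hex (by rwa [Nat.sub_add_cancel hk])
  refine ⟨Nat.find hex + 1, by omega, by omega, Nat.find_spec hex, ?_⟩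
  rcases hs : Nat.find hex with _ | s
  · obtain ⟨f, hf⟩ := hne
    obtain ⟨v⟩ := ‹Nonempty V›
    exact ⟨{f}, by simpa using hf, fun _ => v, fun _ => f, by simp, by omega, by omega,
      by omega, by omega⟩
  · have := hmin s (by omega)
    simp only [NoEdgePath, not_forall, not_not] at this
    obtain ⟨F, hF, c, e, h⟩ := this
    exact ⟨F, hF, c, e, h⟩

/-- Without an edge cycle of length `k - 1`, the edge bound is strict. -/
lemma card_lt_of_noEdgeCycle [Fintype V] (hk : 3 ≤ k) (hkr : k ≤ r) (hSne : S.Nonempty)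
    (hS : ∀ f ∈ H, f ⊆ S) (hH : ∀ f ∈ H, f.card = r) (hno : NoEdgePath H k)
    (hcyc : NoEdgeCycle H (k - 1)) : (r + 1) * H.card < (k - 1) * S.card := by
  induction hn : S.card using Nat.strong_induction_on generalizing S H with
  | _ n ih =>
    subst hn
    rcases H.eq_empty_or_nonempty with rfl | hne
    · simpa using ⟨by omega, hSne⟩
    have hsub : H.biUnion id ⊆ S := Finset.biUnion_subset.2 hS
    have remove : ∀ X ⊆ S, X.Nonempty → (S \ X).Nonempty →
        (r + 1) * (H.filter fun f => ¬ Disjoint f X).card ≤ (k - 1) * X.card →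
        (r + 1) * H.card < (k - 1) * S.card := by
      intro X hXS hX hSX hle
      have hcard := Finset.card_sdiff_add_card_eq_card hXS
      have hXpos := Finset.card_pos.2 hX
      have hlt := ih _ (by omega) hSX (subset_sdiff_of_mem_filter hS)
        (fun f hf => hH f (Finset.mem_filter.1 hf).1) (hno.mono (Finset.filter_subset _ _))
        (hcyc.mono (Finset.filter_subset _ _)) rfl
      rw [← hcard, ← Finset.card_filter_add_card_filter_not (s := H) fun f => Disjoint f X,
        mul_add, mul_add]
      omega
    have : Nonempty V := ⟨hSne.choose⟩
    obtain ⟨t, ht, htk, hnot, F, hFH, c, e, h⟩ := exists_longest_edgePath (by omega) hne hno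
    by_cases hct : NoEdgeCycle H t
    · rcases Nat.lt_or_ge t 2 with ht2 | ht2
      · obtain rfl : t = 1 := by omega
        have h0 := h.mem (i := 0) (by omega)
        obtain ⟨x, hx⟩ := Finset.card_pos.1 (by rw [hH _ (hFH h0)]; omega : 0 < (e 0).card)
        have := hct F hFH c e h x hx hx
        simp [connectors] at this
      · obtain ⟨X, hX, hXne, ⟨v, hv, hvX⟩, hle⟩ :=
          h.exists_sparse_set hFH hH (by omega) ht2 hnot hct
        refine remove X (hX.trans hsub) hXne ⟨v, Finset.mem_sdiff.2 ⟨hsub hv, hvX⟩⟩ (hle.trans ?_)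
        gcongr
        omega
    · have htk' : t ≠ k - 1 := fun heq => hct (heq ▸ hcyc)
      simp only [NoEdgeCycle, not_forall] at hct
      obtain ⟨F, hFH, c, e, h, x, hx0, hxl, hx⟩ := hct
      have hF : ∀ f ∈ F, f.card = r := fun f hf => hH f (hFH hf)
      set W := F.biUnion id with hW
      have hWS : W ⊆ S := (Finset.biUnion_subset_biUnion_of_subset_left _ hFH).trans hsub
      have hWr : r ≤ W.card := h.le_card_biUnion ht hF
      have hmeet : (H.filter fun f => ¬ Disjoint f W) ⊆ F := fun f hf =>
        h.mem_of_meets_cycle hFH hnot hx0 hxl hx (Finset.mem_filter.1 hf).1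
          (Finset.mem_filter.1 hf).2
      have hcard := Finset.card_le_card hmeet
      rw [h.card_eq] at hcard
      have hlt : (r + 1) * (H.filter fun f => ¬ Disjoint f W).card < (k - 1) * W.card := by
        obtain ⟨s, rfl⟩ : ∃ s, k = s + 2 := ⟨k - 2, by omega⟩
        calc (r + 1) * (H.filter fun f => ¬ Disjoint f W).card ≤ (r + 1) * s := by gcongr; omega
          _ < (s + 1) * r := by nlinarith
          _ ≤ (s + 2 - 1) * W.card := by gcongr; omega
      rcases (S \ W).eq_empty_or_nonempty with hSW | hSW
      · obtain rfl : W = S := hWS.antisymm (Finset.sdiff_eq_empty_iff_subset.1 hSW)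
        rwa [Finset.filter_true_of_mem] at hlt
        intro f hf hdisj
        have h0 : f = ∅ := (Finset.disjoint_self_iff_empty f).1 (hdisj.mono_right (hS f hf))
        have hfr := hH f hf
        rw [h0, Finset.card_empty] at hfr
        omega
      · exact remove W hWS (Finset.card_pos.1 (by omega)) hSW hlt.le

lemma card_le_and_dvd_of_noEdgePath [Fintype V] (hk : 3 ≤ k) (hkr : k ≤ r)
    (hS : ∀ f ∈ H, f ⊆ S) (hH : ∀ f ∈ H, f.card = r) (hno : NoEdgePath H k) :
    (r + 1) * H.card ≤ (k - 1) * S.card ∧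
      ((r + 1) * H.card = (k - 1) * S.card → (r + 1) ∣ S.card) := by
  induction hn : S.card using Nat.strong_induction_on generalizing S H with
  | _ n ih =>
    subst hn
    by_cases hcyc : NoEdgeCycle H (k - 1)
    · rcases S.eq_empty_or_nonempty with rfl | hSne
      · have : H = ∅ := by
          refine Finset.eq_empty_of_forall_notMem fun f hf => ?_
          have h1 := hH f hf
          rw [Finset.subset_empty.1 (hS f hf), Finset.card_empty] at h1
          omega
        simp [this]
      · have := card_lt_of_noEdgeCycle hk hkr hSne hS hH hno hcyc
        exact ⟨this.le, fun heq => absurd heq this.ne⟩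
    · simp only [NoEdgeCycle, not_forall] at hcyc
      obtain ⟨F, hFH, c, e, h, x, hx0, hxl, hx⟩ := hcyc
      set W := F.biUnion id with hW
      have hWS : W ⊆ S := Finset.biUnion_subset.2 fun f hf => hS f (hFH hf)
      have hWr : r + 1 ≤ W.card := h.succ_le_card_biUnion (by omega) fun f hf => hH f (hFH hf)
      have hmeet : (H.filter fun f => ¬ Disjoint f W) ⊆ F := fun f hf =>
        h.mem_of_meets_cycle hFH (by rwa [Nat.sub_add_cancel (by omega)]) hx0 hxl hx
          (Finset.mem_filter.1 hf).1 (Finset.mem_filter.1 hf).2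
      have hmeetcard := Finset.card_le_card hmeet
      rw [h.card_eq] at hmeetcard
      have hcard := Finset.card_sdiff_add_card_eq_card hWS
      obtain ⟨hle, hdvd⟩ := ih _ (by omega) (subset_sdiff_of_mem_filter (X := W) hS)
        (fun f hf => hH f (Finset.mem_filter.1 hf).1) (hno.mono (Finset.filter_subset _ _)) rfl
      have h1 : (r + 1) * (H.filter fun f => ¬ Disjoint f W).card ≤ (k - 1) * (r + 1) := by
        rw [mul_comm]
        gcongr
      have h2 : (k - 1) * (r + 1) ≤ (k - 1) * W.card := by gcongr
      rw [← hcard, ← Finset.card_filter_add_card_filter_not (s := H) fun f => Disjoint f W,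
        mul_add, mul_add]
      refine ⟨by omega, fun heq => ?_⟩
      have hWeq : r + 1 = W.card :=
        Nat.eq_of_mul_eq_mul_left (by omega : 0 < k - 1) (by omega)
      exact dvd_add (hdvd (by omega)) (dvd_of_eq hWeq)

/-- In a hypergraph of large uniformity, an edge path extends to a Berge-path of equal length. -/
lemma EdgePath.nonempty_bergePath (h : EdgePath F k c e) (hFH : F ⊆ H)
    (hF : ∀ f ∈ F, f.card = r) (hk : 2 ≤ k) (hkr : k ≤ r) : Nonempty (BergePath H k) := by
  have hpos : ∀ f ∈ F, 1 ≤ (f \ connectors k c).card := by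
    intro f hf
    have h1 := Finset.le_card_sdiff (connectors k c) f
    rw [hF f hf, h.card_connectors] at h1
    omega
  have h0 : e 0 ∈ F := h.mem (by omega)
  have hl : e (k - 1) ∈ F := h.mem (by omega)
  obtain ⟨a, ha, b, hb, hab⟩ : ∃ a ∈ e 0 \ connectors k c, ∃ b ∈ e (k - 1) \ connectors k c,
      a ≠ b := by
    by_contra! hall
    obtain ⟨z, hz⟩ := Finset.card_pos.1 (hpos _ h0)
    obtain ⟨w, hw⟩ := Finset.card_pos.1 (hpos _ hl)
    obtain rfl := hall z hz w hw
    have hsub0 : e 0 ⊆ insert z (connectors k c) := fun y hy => by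
      by_cases hyc : y ∈ connectors k c
      · exact Finset.mem_insert_of_mem hyc
      · rw [hall y (Finset.mem_sdiff.2 ⟨hy, hyc⟩) z hw]
        exact Finset.mem_insert_self _ _
    have hsubl : e (k - 1) ⊆ insert z (connectors k c) := fun y hy => by
      by_cases hyc : y ∈ connectors k c
      · exact Finset.mem_insert_of_mem hyc
      · rw [← hall z hz y (Finset.mem_sdiff.2 ⟨hy, hyc⟩)]
        exact Finset.mem_insert_self _ _
    have hcard : (insert z (connectors k c)).card ≤ r :=
      (Finset.card_insert_le _ _).trans (by rw [h.card_connectors]; omega)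
    have heq : e 0 = e (k - 1) :=
      (Finset.eq_of_subset_of_card_le hsub0 (by rwa [hF _ h0])).trans
        (Finset.eq_of_subset_of_card_le hsubl (by rwa [hF _ hl])).symm
    have := h.edges_inj 0 (k - 1) (by omega) (by omega) heq
    omega
  rw [Finset.mem_sdiff, mem_connectors] at ha hb
  push Not at ha hb
  refine ⟨⟨fun i => if (i : ℕ) = 0 then a else if (i : ℕ) = k then b else c i, fun i => e i,
    ?_, ?_, fun i => hFH (h.mem i.2), ?_, ?_⟩⟩
  · intro i j hij
    have hi := i.2
    have hj := j.2
    apply Fin.ext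
    dsimp only at hij
    split_ifs at hij <;> first
      | omega
      | exact absurd hij hab
      | exact absurd hij.symm hab
      | exact absurd hij (ha.2 _ (by omega) (by omega))
      | exact absurd hij.symm (ha.2 _ (by omega) (by omega))
      | exact absurd hij (hb.2 _ (by omega) (by omega))
      | exact absurd hij.symm (hb.2 _ (by omega) (by omega))
      | exact h.conn_inj _ _ (by omega) (by omega) (by omega) (by omega) hij
  · intro i j hij
    exact Fin.ext (h.edges_inj i j i.2 j.2 hij)
  · intro i
    have hi := i.2
    simp only [Fin.val_castSucc]
    split_ifs with hi0 hik
    · rw [hi0]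
      exact ha.1
    · omega
    · have := h.right (i - 1) (by omega)
      rwa [Nat.sub_add_cancel (by omega)] at this
  · intro i
    have hi := i.2
    change (if (i : ℕ) + 1 = 0 then a else if (i : ℕ) + 1 = k then b else c ((i : ℕ) + 1)) ∈ e i
    rw [if_neg (by omega)]
    split_ifs with hik
    · rw [show (i : ℕ) = k - 1 by omega]
      exact hb.1
    · exact h.left i (by omega)

end Counting

/-- Győri–Katona–Lemons. For `r ≥ k ≥ 3`, every `r`-uniform hypergraph
on `n` vertices with no Berge-path of length `k` has at most `(k−1)n/(r+1)` hyperedges;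
in case of equality `(r+1) ∣ n`. -/
theorem gyori_katona_lemons_small_k
    (n r k : ℕ) (hkr : k ≤ r) (hk : 3 ≤ k) (H : Finset (Finset (Fin n)))
    (huni : ∀ e ∈ H, e.card = r) (hpath : IsEmpty (BergePath H k)) :
    (r + 1) * H.card ≤ (k - 1) * n ∧
      ((r + 1) * H.card = (k - 1) * n → (r + 1) ∣ n) := by
  have hno : NoEdgePath H k := fun F hF c e h =>
    not_nonempty_iff.2 hpath
      (h.nonempty_bergePath hF (fun f hf => huni f (hF hf)) (by omega) hkr)
  simpa using card_le_and_dvd_of_noEdgePath hk hkr (S := Finset.univ)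
    (fun f _ => Finset.subset_univ f) huni hno
end

section
/- For all integers n, r, k with k > r + 1 > 3, every r-uniform hypergraph on n vertices containing no Berge-path of length k has at most (n/k)·C(k, r) hyperedges; moreover, if the number of hyperedges equals (n/k)·C(k, r), then k divides n. -/
open scoped Classical

/-- `l` lists the vertices of a path of `G` inside `S`. -/
def IsPathList {V : Type*} (G : SimpleGraph V) (S : Finset V) (l : List V) : Prop :=
  l.Nodup ∧ l.IsChain G.Adj ∧ ∀ x ∈ l, x ∈ S

/-- Every path of `G` inside `S` has at most `m` vertices. -/
def PathsBounded {V : Type*} (G : SimpleGraph V) (S : Finset V) (m : ℕ) : Prop :=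
  ∀ l, IsPathList G S l → l.length ≤ m

/-- The number of neighbours of `v` inside `S`. -/
noncomputable def degIn {V : Type*} (G : SimpleGraph V) (S : Finset V) (v : V) : ℕ :=
  (S.filter (G.Adj v)).card

/-- The `s`-vertex cliques of `G` inside `S`. -/
noncomputable def cliquesIn {V : Type*} (G : SimpleGraph V) (S : Finset V) (s : ℕ) :
    Finset (Finset V) :=
  (S.powersetCard s).filter (fun T => ∀ a ∈ T, ∀ b ∈ T, a ≠ b → G.Adj a b)

section Paths

variable {V : Type*} {G G' : SimpleGraph V} {S T : Finset V} {m : ℕ}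

theorem PathsBounded.mono (h : PathsBounded G S m) (hT : T ⊆ S) (hG : G' ≤ G) :
    PathsBounded G' T m := fun l hl =>
  h l ⟨hl.1, hl.2.1.imp fun _ _ hab => hG hab, fun x hx => hT (hl.2.2 x hx)⟩

theorem IsPathList.cons {l : List V} {v : V} (hl : IsPathList G S l) (hv : v ∈ S)
    (hvl : v ∉ l) (hadj : ∀ x ∈ l.head?, G.Adj v x) : IsPathList G S (v :: l) := by
  refine ⟨List.nodup_cons.2 ⟨hvl, hl.1⟩, List.isChain_cons.2 ⟨hadj, hl.2.1⟩, ?_⟩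
  intro x hx
  rcases List.mem_cons.1 hx with rfl | hx
  · exact hv
  · exact hl.2.2 x hx

theorem IsPathList.reverse {l : List V} (hl : IsPathList G S l) : IsPathList G S l.reverse := by
  refine ⟨List.nodup_reverse.2 hl.1, List.isChain_reverse.2 ?_, fun x hx =>
    hl.2.2 x (List.mem_reverse.1 hx)⟩
  exact hl.2.1.imp fun _ _ h => h.symm

theorem PathsBounded.neighbors (h : PathsBounded G S (m + 1)) {v : V} (hv : v ∈ S) :
    PathsBounded G (S.filter (G.Adj v)) m := by
  intro l hl
  have hl' : IsPathList G S l := ⟨hl.1, hl.2.1, fun x hx => (Finset.mem_filter.1 (hl.2.2 x hx)).1⟩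
  have hadj : ∀ x ∈ l, G.Adj v x := fun x hx => (Finset.mem_filter.1 (hl.2.2 x hx)).2
  have := h _ (hl'.cons hv (fun hvl => G.loopless.irrefl v (hadj v hvl))
    fun x hx => hadj x (List.mem_of_mem_head? hx))
  simpa using this

/-- A vertex outside a cycle spanned by a path, but adjacent to it, extends the path. -/
theorem IsPathList.exists_longer_of_cycle {l : List V} (hl : IsPathList G S l)
    (hcyc : ∀ a ∈ l.getLast?, ∀ b ∈ l.head?, G.Adj a b) {x y : V} (hx : x ∈ l)
    (hy : y ∈ S) (hyl : y ∉ l) (hxy : G.Adj y x) :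
    ∃ l', IsPathList G S l' ∧ l'.length = l.length + 1 := by
  obtain ⟨c, d, rfl⟩ := List.append_of_mem hx
  refine ⟨y :: ((x :: d) ++ c), IsPathList.cons ⟨?_, ?_, ?_⟩ hy ?_ ?_, ?_⟩
  · exact (List.perm_append_comm.nodup_iff).1 hl.1
  · have h := List.isChain_append.1 hl.2.1
    refine List.isChain_append.2 ⟨h.2.1, h.1, fun a ha b hb => hcyc a ?_ b ?_⟩
    · simp_all [List.getLast?_append]
    · cases c <;> simp_all
  · intro z hz
    exact hl.2.2 z (List.perm_append_comm.mem_iff.1 hz)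
  · intro hz
    exact hyl (List.perm_append_comm.mem_iff.1 hz)
  · intro z hz
    simp only [List.cons_append, List.head?_cons, Option.mem_def, Option.some.injEq] at hz
    exact hz ▸ hxy
  · simp
    omega

/-- Replacing the crossing edge of a path by two chords from its ends gives a cycle. -/
theorem IsPathList.exists_longer_of_crossing {l : List V} (hl : IsPathList G S l) {i : ℕ}
    (hi : i + 1 < l.length) (hhead : G.Adj l[0] l[i + 1])
    (hlast : G.Adj l[l.length - 1] l[i]) {x y : V} (hx : x ∈ l)
    (hy : y ∈ S) (hyl : y ∉ l) (hxy : G.Adj y x) :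
    ∃ l', IsPathList G S l' ∧ l'.length = l.length + 1 := by
  have hsplit := List.take_append_drop (i + 1) l
  set c := l.take (i + 1) with hc
  set d := l.drop (i + 1) with hd
  have hperm : (c ++ d.reverse).Perm l := by
    rw [← hsplit]
    exact (List.reverse_perm d).append_left c
  have hch := hl.2.1
  rw [← hsplit] at hch
  have h := List.isChain_append.1 hch
  have hpath : IsPathList G S (c ++ d.reverse) := by
    refine ⟨hperm.nodup_iff.2 hl.1, List.isChain_append.2 ⟨h.1, ?_, ?_⟩, fun z hz =>
      hl.2.2 z (hperm.mem_iff.1 hz)⟩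
    · exact List.isChain_reverse.2 (h.2.1.imp fun _ _ h => h.symm)
    · intro a ha b hb
      have e1 : c.getLast? = some l[i] := by
        simp [hc, List.getLast?_take, show i < l.length by omega]
      have e2 : d.reverse.head? = some l[l.length - 1] := by
        rw [List.head?_reverse, hd, List.getLast?_drop, if_neg (by omega),
          List.getLast?_eq_getElem?, List.getElem?_eq_getElem (by omega)]
      rw [e1] at ha
      rw [e2] at hb
      cases ha
      cases hb
      exact hlast.symm
  have hcyc : ∀ a ∈ (c ++ d.reverse).getLast?, ∀ b ∈ (c ++ d.reverse).head?, G.Adj a b := by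
    intro a ha b hb
    have e1 : (c ++ d.reverse).getLast? = some l[i + 1] := by
      rw [List.getLast?_append, List.getLast?_reverse, hd, List.head?_drop,
        List.getElem?_eq_getElem hi]
      rfl
    have e2 : (c ++ d.reverse).head? = some l[0] := by
      rw [List.head?_append, hc, List.head?_take, if_neg (by omega), List.head?_eq_getElem?,
        List.getElem?_eq_getElem (by omega)]
      rfl
    rw [e1] at ha
    rw [e2] at hb
    cases ha
    cases hb
    exact hhead.symm
  obtain ⟨l', h1, h2⟩ := hpath.exists_longer_of_cycle hcyc (hperm.mem_iff.2 hx) hy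
    (fun hz => hyl (hperm.mem_iff.1 hz)) hxy
  exact ⟨l', h1, by rw [h2, hperm.length_eq]⟩

/-- The ends of a longest path that does not span a component have small degree sum. -/
theorem IsPathList.degIn_ends_lt {l : List V} (hl : IsPathList G S l) (hpos : 0 < l.length)
    (hmax : PathsBounded G S l.length) {x y : V} (hx : x ∈ l)
    (hy : y ∈ S) (hyl : y ∉ l) (hxy : G.Adj y x) :
    degIn G S l[0] + degIn G S l[l.length - 1] < l.length := by
  have hnot : ¬ ∃ l', IsPathList G S l' ∧ l'.length = l.length + 1 := by
    rintro ⟨l', h1, h2⟩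
    have := hmax l' h1
    omega
  have hN0 : ∀ w ∈ S, G.Adj l[0] w → w ∈ l := by
    intro w hw hadj
    by_contra hwl
    refine hnot ⟨w :: l, hl.cons hw hwl ?_, by simp⟩
    intro z hz
    rw [List.head?_eq_getElem?, List.getElem?_eq_getElem hpos] at hz
    cases hz
    exact hadj.symm
  have hN1 : ∀ w ∈ S, G.Adj l[l.length - 1] w → w ∈ l := by
    intro w hw hadj
    by_contra hwl
    refine hnot ⟨w :: l.reverse, hl.reverse.cons hw (by simpa using hwl) ?_, by simp⟩
    intro z hz
    rw [List.head?_reverse, List.getLast?_eq_getElem?,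
      List.getElem?_eq_getElem (by omega)] at hz
    cases hz
    exact hadj.symm
  set A := (Finset.range (l.length - 1)).filter
    (fun i => ∀ h : i + 1 < l.length, G.Adj l[0] l[i + 1]) with hA
  set B := (Finset.range (l.length - 1)).filter
    (fun i => ∀ h : i < l.length, G.Adj l[l.length - 1] l[i]) with hB
  have hcA : degIn G S l[0] ≤ A.card := by
    refine (Finset.card_le_card ?_).trans
      (Finset.card_image_le (s := A) (f := fun i => l.getD (i + 1) l[0]))
    intro w hw
    obtain ⟨hwS, hadj⟩ := Finset.mem_filter.1 hw
    obtain ⟨j, hj, rfl⟩ := List.getElem_of_mem (hN0 w hwS hadj)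
    obtain _ | j := j
    · exact absurd hadj (G.loopless.irrefl _)
    · refine Finset.mem_image.2 ⟨j, Finset.mem_filter.2 ⟨?_, fun _ => hadj⟩, ?_⟩
      · rw [Finset.mem_range]
        omega
      · simp [hj]
  have hcB : degIn G S l[l.length - 1] ≤ B.card := by
    refine (Finset.card_le_card ?_).trans
      (Finset.card_image_le (s := B) (f := fun i => l.getD i l[0]))
    intro w hw
    obtain ⟨hwS, hadj⟩ := Finset.mem_filter.1 hw
    obtain ⟨j, hj, rfl⟩ := List.getElem_of_mem (hN1 w hwS hadj)
    refine Finset.mem_image.2 ⟨j, Finset.mem_filter.2 ⟨?_, fun _ => hadj⟩, ?_⟩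
    · rw [Finset.mem_range]
      have : j ≠ l.length - 1 := by
        rintro rfl
        exact G.loopless.irrefl _ hadj
      omega
    · simp [hj]
  have hdisj : Disjoint A B := by
    rw [Finset.disjoint_left]
    intro i hiA hiB
    obtain ⟨h1, h2⟩ := Finset.mem_filter.1 hiA
    obtain ⟨-, h3⟩ := Finset.mem_filter.1 hiB
    rw [Finset.mem_range] at h1
    exact hnot (hl.exists_longer_of_crossing (by omega) (h2 (by omega)) (h3 (by omega))
      hx hy hyl hxy)
  have hAB : (A ∪ B).card ≤ l.length - 1 := by
    refine (Finset.card_le_card (Finset.union_subset (Finset.filter_subset _ _)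
      (Finset.filter_subset _ _))).trans ?_
    simp
  rw [Finset.card_union_of_disjoint hdisj] at hAB
  omega

theorem PathsBounded.exists_longest (h : PathsBounded G S m) (hS : S.Nonempty) :
    ∃ l, IsPathList G S l ∧ 0 < l.length ∧ PathsBounded G S l.length := by
  obtain ⟨v, hv⟩ := hS
  have hv' : IsPathList G S [v] := by simp [IsPathList, hv]
  have hb : ∀ p, (∃ l, IsPathList G S l ∧ l.length = p) → p ≤ m := by
    rintro p ⟨l, hl, rfl⟩
    exact h l hl
  obtain ⟨p, ⟨l, hl, rfl⟩, hmax⟩ : ∃ p, (∃ l, IsPathList G S l ∧ l.length = p) ∧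
      ∀ q, (∃ l, IsPathList G S l ∧ l.length = q) → q ≤ p := by
    refine ⟨_, Nat.findGreatest_spec (P := fun p => ∃ l, IsPathList G S l ∧ l.length = p)
      (hb 1 ⟨[v], hv', rfl⟩) ⟨[v], hv', rfl⟩, fun q hq => Nat.le_findGreatest (hb q hq) hq⟩
  exact ⟨l, hl, hmax 1 ⟨[v], hv', rfl⟩, fun l' hl' => hmax _ ⟨l', hl', rfl⟩⟩

end Paths

section ErdosGallai

variable {V : Type*} {G : SimpleGraph V} {S : Finset V} {m : ℕ}

/-- Inside `S` the graph `G` is a disjoint union of cliques on `m + 1` vertices. -/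
def IsCliqueUnion (G : SimpleGraph V) (S : Finset V) (m : ℕ) : Prop :=
  (∀ v ∈ S, degIn G S v = m) ∧
    ∀ a ∈ S, ∀ b ∈ S, ∀ c ∈ S, G.Adj a b → G.Adj b c → a ≠ c → G.Adj a c

theorem degIn_le_card_sub_one {v : V} (hv : v ∈ S) : degIn G S v ≤ S.card - 1 := by
  rw [← Finset.card_erase_of_mem hv]
  refine Finset.card_le_card fun w hw => ?_
  obtain ⟨hwS, hadj⟩ := Finset.mem_filter.1 hw
  exact Finset.mem_erase.2 ⟨hadj.ne', hwS⟩

theorem adj_of_degIn_eq {v w : V} (hv : v ∈ S) (hw : w ∈ S) (hvw : v ≠ w)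
    (h : degIn G S v = S.card - 1) : G.Adj v w := by
  have hsub : S.filter (G.Adj v) ⊆ S.erase v := fun w hw => by
    obtain ⟨hwS, hadj⟩ := Finset.mem_filter.1 hw
    exact Finset.mem_erase.2 ⟨hadj.ne', hwS⟩
  have heq := Finset.eq_of_subset_of_card_le hsub
    (by rw [Finset.card_erase_of_mem hv, ← h, degIn])
  have : w ∈ S.filter (G.Adj v) := by
    rw [heq]
    exact Finset.mem_erase.2 ⟨hvw.symm, hw⟩
  exact (Finset.mem_filter.1 this).2

theorem degIn_eq_of_no_cross {X : Finset V} (hX : X ⊆ S) {v : V}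
    (h : ∀ w ∈ S, w ∉ X → ¬ G.Adj v w) : degIn G S v = degIn G X v := by
  unfold degIn
  congr 1
  ext w
  simp only [Finset.mem_filter]
  constructor
  · rintro ⟨hw, hadj⟩
    exact ⟨by_contra fun hwX => h w hw hwX hadj, hadj⟩
  · rintro ⟨hw, hadj⟩
    exact ⟨hX hw, hadj⟩

theorem sum_degIn_erase {v : V} (hv : v ∈ S) :
    ∑ w ∈ S, degIn G S w = ∑ w ∈ S.erase v, degIn G (S.erase v) w + 2 * degIn G S v := by
  have hstep : ∀ w ∈ S.erase v,
      degIn G S w = degIn G (S.erase v) w + if G.Adj v w then 1 else 0 := by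
    intro w _
    unfold degIn
    rw [Finset.filter_erase]
    by_cases hadj : G.Adj v w
    · have hmem : v ∈ S.filter (G.Adj w) := Finset.mem_filter.2 ⟨hv, hadj.symm⟩
      rw [if_pos hadj, Finset.card_erase_add_one hmem]
    · have hmem : v ∉ S.filter (G.Adj w) := fun h => hadj (Finset.mem_filter.1 h).2.symm
      rw [if_neg hadj, Finset.erase_eq_of_notMem hmem, add_zero]
  have hcount : ∑ w ∈ S.erase v, (if G.Adj v w then 1 else 0) = degIn G S v := by
    rw [← Finset.card_filter, degIn, Finset.filter_erase, Finset.erase_eq_of_notMem]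
    exact fun h => G.loopless.irrefl v (Finset.mem_filter.1 h).2
  rw [← Finset.sum_erase_add S _ hv, Finset.sum_congr rfl hstep, Finset.sum_add_distrib, hcount]
  ring

theorem sum_degIn_of_no_cross {X : Finset V} (hX : X ⊆ S)
    (h : ∀ x ∈ X, ∀ y ∈ S, y ∉ X → ¬ G.Adj x y) :
    (∀ v ∈ X, degIn G S v = degIn G X v) ∧ (∀ v ∈ S \ X, degIn G S v = degIn G (S \ X) v) ∧
    ∑ w ∈ S, degIn G S w = ∑ w ∈ X, degIn G X w + ∑ w ∈ S \ X, degIn G (S \ X) w := by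
  have h1 : ∀ v ∈ X, degIn G S v = degIn G X v := fun v hv =>
    degIn_eq_of_no_cross hX fun w hw hwX => h v hv w hw hwX
  have h2 : ∀ v ∈ S \ X, degIn G S v = degIn G (S \ X) v := fun v hv =>
    degIn_eq_of_no_cross Finset.sdiff_subset fun w hw hwX hadj => by
      rw [Finset.mem_sdiff] at hv hwX
      exact h w (by_contra fun hw' => hwX ⟨hw, hw'⟩) v hv.1 hv.2 hadj.symm
  refine ⟨h1, h2, ?_⟩
  rw [← Finset.sum_sdiff hX, add_comm, Finset.sum_congr rfl h1, Finset.sum_congr rfl h2]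

theorem IsPathList.of_clique {T : Finset V} (hT : T ⊆ S)
    (h : ∀ a ∈ T, ∀ b ∈ T, a ≠ b → G.Adj a b) : IsPathList G S T.toList := by
  refine ⟨T.nodup_toList, List.Pairwise.isChain ?_, fun x hx => hT (Finset.mem_toList.1 hx)⟩
  exact T.nodup_toList.imp_of_mem fun ha hb hab =>
    h _ (Finset.mem_toList.1 ha) _ (Finset.mem_toList.1 hb) hab

/-- A vertex with a neighbour in a union of `(m + 1)`-cliques starts a path on `m + 2` vertices. -/
theorem IsCliqueUnion.not_adj_of_pathsBounded {v : V} (hv : v ∈ S)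
    (hS : IsCliqueUnion G (S.erase v) m) (hb : PathsBounded G S (m + 1)) {u : V} (hu : u ∈ S) :
    ¬ G.Adj v u := by
  intro hvu
  have hu' : u ∈ S.erase v := Finset.mem_erase.2 ⟨hvu.ne', hu⟩
  set T := (S.erase v).filter (G.Adj u) with hT
  have hTcard : T.card = m := hS.1 u hu'
  have hTS : T ⊆ S := (Finset.filter_subset _ _).trans (Finset.erase_subset _ _)
  have hclique : ∀ a ∈ T, ∀ b ∈ T, a ≠ b → G.Adj a b := by
    intro a ha b hb hab
    obtain ⟨ha, hua⟩ := Finset.mem_filter.1 ha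
    obtain ⟨hb, hub⟩ := Finset.mem_filter.1 hb
    exact hS.2 a ha u hu' b hb hua.symm hub hab
  have hpath : IsPathList G S (u :: T.toList) := by
    refine (IsPathList.of_clique hTS hclique).cons hu ?_ ?_
    · intro h
      exact G.loopless.irrefl u (Finset.mem_filter.1 (Finset.mem_toList.1 h)).2
    · intro x hx
      exact (Finset.mem_filter.1 (Finset.mem_toList.1 (List.mem_of_mem_head? hx))).2
  have hpath' : IsPathList G S (v :: u :: T.toList) := by
    refine hpath.cons hv ?_ ?_
    · intro h
      rcases List.mem_cons.1 h with h | h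
      · exact hvu.ne h
      · exact Finset.notMem_erase v S (Finset.mem_filter.1 (Finset.mem_toList.1 h)).1
    · intro x hx
      cases hx
      exact hvu
  have := hb _ hpath'
  simp [hTcard] at this

/-- **Erdős–Gallai**, with the structure of the extremal graphs. -/
theorem PathsBounded.sum_degIn_le (hb : PathsBounded G S (m + 1)) :
    ∑ v ∈ S, degIn G S v ≤ m * S.card ∧
      (0 < m → ∑ v ∈ S, degIn G S v = m * S.card → IsCliqueUnion G S m) := by
  induction S using Finset.strongInduction with
  | H S ih =>
  rcases S.eq_empty_or_nonempty with rfl | hne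
  · simp [IsCliqueUnion]
  obtain ⟨l, hl, hpos, hmax⟩ := hb.exists_longest hne
  have hlm : l.length ≤ m + 1 := hb l hl
  by_cases hcross : ∃ x ∈ l, ∃ y ∈ S, y ∉ l ∧ G.Adj y x
  · obtain ⟨x, hx, y, hy, hyl, hxy⟩ := hcross
    have hends := hl.degIn_ends_lt hpos hmax hx hy hyl hxy
    obtain ⟨v, hv, hdeg⟩ : ∃ v ∈ S, 2 * degIn G S v ≤ m := by
      by_cases h0 : 2 * degIn G S l[0] ≤ m
      · exact ⟨_, hl.2.2 _ (List.getElem_mem _), h0⟩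
      · exact ⟨l[l.length - 1], hl.2.2 _ (List.getElem_mem _), by omega⟩
    obtain ⟨h1, h2⟩ := ih (S.erase v) (Finset.erase_ssubset hv)
      (hb.mono (Finset.erase_subset _ _) le_rfl)
    have hcard : S.card = (S.erase v).card + 1 := (Finset.card_erase_add_one hv).symm
    rw [sum_degIn_erase hv, hcard, mul_add, mul_one]
    refine ⟨by omega, fun hm heq => ?_⟩
    have hdeg' : 0 < degIn G S v := by omega
    obtain ⟨u, hu⟩ := Finset.card_pos.1 hdeg'
    obtain ⟨huS, hvu⟩ := Finset.mem_filter.1 hu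
    exact absurd hvu ((h2 hm (by omega)).not_adj_of_pathsBounded hv hb huS)
  · push Not at hcross
    have hX : l.toFinset ⊆ S := fun x hx => hl.2.2 x (List.mem_toFinset.1 hx)
    have hXcard : l.toFinset.card = l.length := List.toFinset_card_of_nodup hl.1
    set X := l.toFinset with hXdef
    have hno : ∀ x ∈ X, ∀ y ∈ S, y ∉ X → ¬ G.Adj x y := fun x hx y hy hyX hadj =>
      hcross x (List.mem_toFinset.1 hx) y hy (fun h => hyX (List.mem_toFinset.2 h)) hadj.symm
    obtain ⟨hd1, hd2, hsum⟩ := sum_degIn_of_no_cross hX hno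
    have hXne : X.Nonempty := Finset.card_pos.1 (by omega)
    obtain ⟨h1, h2⟩ := ih (S \ X) (Finset.sdiff_ssubset hX hXne)
      (hb.mono Finset.sdiff_subset le_rfl)
    have hcard : S.card = X.card + (S \ X).card := by
      rw [add_comm, Finset.card_sdiff_add_card_eq_card hX]
    have hXdeg : ∀ v ∈ X, degIn G X v ≤ m := fun v hv =>
      (degIn_le_card_sub_one hv).trans (by omega)
    have hXsum : ∑ v ∈ X, degIn G X v ≤ m * X.card := by
      refine (Finset.sum_le_card_nsmul X _ m hXdeg).trans ?_
      simp [mul_comm]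
    rw [hsum, hcard, mul_add]
    refine ⟨by omega, fun hm heq => ?_⟩
    obtain ⟨g1, g2⟩ := h2 hm (by omega)
    have hXeq : ∀ v ∈ X, degIn G X v = m := by
      have := (Finset.sum_eq_sum_iff_of_le hXdeg).1 (by
        rw [Finset.sum_const, smul_eq_mul, mul_comm]
        omega)
      exact this
    have hXm : X.card - 1 = m := by
      obtain ⟨v, hv⟩ := hXne
      have h1 := degIn_le_card_sub_one (G := G) hv
      have h2 := hXeq v hv
      omega
    refine ⟨fun v hv => ?_, fun a ha b hb c hc hab hbc hac => ?_⟩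
    · by_cases hvX : v ∈ X
      · rw [hd1 v hvX, hXeq v hvX]
      · have hv' := Finset.mem_sdiff.2 ⟨hv, hvX⟩
        rw [hd2 v hv', g1 v hv']
    · by_cases hbX : b ∈ X
      · have haX : a ∈ X := by_contra fun h => hno b hbX a ha h hab.symm
        have hcX : c ∈ X := by_contra fun h => hno b hbX c hc h hbc
        exact adj_of_degIn_eq haX hcX hac (by rw [hXeq a haX, hXm])
      · have haX : a ∉ X := fun h => hno a h b hb hbX hab
        have hcX : c ∉ X := fun h => hno c h b hb hbX hbc.symm
        exact g2 a (Finset.mem_sdiff.2 ⟨ha, haX⟩) b (Finset.mem_sdiff.2 ⟨hb, hbX⟩) c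
          (Finset.mem_sdiff.2 ⟨hc, hcX⟩) hab hbc hac

theorem IsCliqueUnion.dvd_card (h : IsCliqueUnion G S m) : m + 1 ∣ S.card := by
  induction S using Finset.strongInduction with
  | H S ih =>
  rcases S.eq_empty_or_nonempty with rfl | ⟨u, hu⟩
  · simp
  set X := insert u (S.filter (G.Adj u)) with hXdef
  have hX : X ⊆ S := Finset.insert_subset hu (Finset.filter_subset _ _)
  have huX : u ∈ X := Finset.mem_insert_self _ _
  have hXcard : X.card = m + 1 := by
    rw [Finset.card_insert_of_notMem, ← h.1 u hu, degIn]
    exact fun h => G.loopless.irrefl u (Finset.mem_filter.1 h).2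
  have hno : ∀ x ∈ X, ∀ y ∈ S, y ∉ X → ¬ G.Adj x y := by
    intro x hx y hy hyX hadj
    refine hyX (Finset.mem_insert_of_mem (Finset.mem_filter.2 ⟨hy, ?_⟩))
    rcases Finset.mem_insert.1 hx with rfl | hx'
    · exact hadj
    · exact h.2 u hu x (hX hx) y hy (Finset.mem_filter.1 hx').2 hadj
        (fun huy => hyX (huy ▸ huX))
  obtain ⟨-, hd2, -⟩ := sum_degIn_of_no_cross hX hno
  have := ih (S \ X) (Finset.sdiff_ssubset hX ⟨u, huX⟩)
    ⟨fun v hv => by rw [← hd2 v hv, h.1 v (Finset.sdiff_subset hv)], fun a ha b hb c hc =>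
      h.2 a (Finset.sdiff_subset ha) b (Finset.sdiff_subset hb) c (Finset.sdiff_subset hc)⟩
  rw [← Finset.card_sdiff_add_card_eq_card hX, hXcard]
  exact this.add dvd_rfl

end ErdosGallai

section Cliques

variable {V : Type*} {G : SimpleGraph V} {S : Finset V} {m s : ℕ}

theorem mem_cliquesIn {T : Finset V} : T ∈ cliquesIn G S s ↔
    (T ⊆ S ∧ T.card = s) ∧ ∀ a ∈ T, ∀ b ∈ T, a ≠ b → G.Adj a b := by
  rw [cliquesIn, Finset.mem_filter, Finset.mem_powersetCard]

theorem succ_mul_card_cliquesIn_le (s : ℕ) :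
    (s + 1) * (cliquesIn G S (s + 1)).card ≤
      ∑ v ∈ S, (cliquesIn G (S.filter (G.Adj v)) s).card := by
  have hdc := Finset.sum_card_bipartiteAbove_eq_sum_card_bipartiteBelow
    (s := S) (t := cliquesIn G S (s + 1)) (fun v T => v ∈ T)
  have hright : ∑ T ∈ cliquesIn G S (s + 1),
      (Finset.bipartiteBelow (fun v T => v ∈ T) S T).card =
      (s + 1) * (cliquesIn G S (s + 1)).card := by
    rw [Finset.sum_const_nat (m := s + 1), mul_comm]
    intro T hT
    obtain ⟨hTS, hTc⟩ := Finset.mem_powersetCard.1 (Finset.mem_filter.1 hT).1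
    rw [← hTc, Finset.bipartiteBelow, Finset.filter_mem_eq_inter,
      Finset.inter_eq_right.2 hTS]
  rw [← hright, ← hdc]
  refine Finset.sum_le_sum fun v _ => ?_
  refine Finset.card_le_card_of_injOn (fun T => T.erase v) ?_ ?_
  · intro T hT
    obtain ⟨hT, hvT⟩ := Finset.mem_filter.1 hT
    obtain ⟨hT, hcl⟩ := Finset.mem_filter.1 hT
    obtain ⟨hTS, hTc⟩ := Finset.mem_powersetCard.1 hT
    refine Finset.mem_filter.2 ⟨Finset.mem_powersetCard.2 ⟨fun w hw => ?_, ?_⟩, ?_⟩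
    · obtain ⟨hwv, hwT⟩ := Finset.mem_erase.1 hw
      exact Finset.mem_filter.2 ⟨hTS hwT, hcl v hvT w hwT hwv.symm⟩
    · rw [Finset.card_erase_of_mem hvT, hTc, Nat.add_sub_cancel]
    · exact fun a ha b hb => hcl a (Finset.mem_of_mem_erase ha) b (Finset.mem_of_mem_erase hb)
  · intro T hT T' hT' heq
    have h1 : v ∈ T := (Finset.mem_filter.1 hT).2
    have h2 : v ∈ T' := (Finset.mem_filter.1 hT').2
    rw [← Finset.insert_erase h1, ← Finset.insert_erase h2]
    exact congrArg (insert v) heq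

/-- **Luo's bound** on the number of cliques in a graph without long paths. -/
theorem PathsBounded.card_cliquesIn_le (hm : 0 < m) (hb : PathsBounded G S m) :
    m * (cliquesIn G S (s + 1)).card ≤ S.card * m.choose (s + 1) := by
  induction s generalizing m S with
  | zero =>
    have : (cliquesIn G S 1).card ≤ S.card := by
      refine (Finset.card_le_card (Finset.filter_subset _ _)).trans ?_
      simp
    simp only [zero_add, Nat.choose_one_right]
    rw [mul_comm]
    exact Nat.mul_le_mul_right _ this
  | succ s ih =>
    obtain ⟨m, rfl⟩ : ∃ m', m = m' + 1 := ⟨m - 1, by omega⟩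
    have hcount := succ_mul_card_cliquesIn_le (G := G) (S := S) (s + 1)
    have hEG := hb.sum_degIn_le.1
    rcases Nat.eq_zero_or_pos m with rfl | hm'
    · have hzero : ∑ v ∈ S, (cliquesIn G (S.filter (G.Adj v)) (s + 1)).card = 0 := by
        refine Finset.sum_eq_zero fun v hv => ?_
        have hdeg : degIn G S v = 0 := by
          rw [zero_mul, Nat.le_zero, Finset.sum_eq_zero_iff] at hEG
          exact hEG v hv
        rw [Finset.card_eq_zero.1 hdeg]
        simp [cliquesIn]
      have : (cliquesIn G S (s + 1 + 1)).card = 0 := by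
        rw [hzero] at hcount
        simpa using hcount
      simp [this]
    · have hsum : m * ∑ v ∈ S, (cliquesIn G (S.filter (G.Adj v)) (s + 1)).card ≤
          (∑ v ∈ S, degIn G S v) * m.choose (s + 1) := by
        rw [Finset.mul_sum, Finset.sum_mul]
        exact Finset.sum_le_sum fun v hv => ih hm' (hb.neighbors hv)
      have hmain : (s + 2) * (cliquesIn G S (s + 1 + 1)).card ≤ S.card * m.choose (s + 1) := by
        refine Nat.le_of_mul_le_mul_left ?_ hm'
        calc m * ((s + 2) * (cliquesIn G S (s + 1 + 1)).card)
            ≤ (∑ v ∈ S, degIn G S v) * m.choose (s + 1) :=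
              (Nat.mul_le_mul_left m hcount).trans hsum
          _ ≤ m * S.card * m.choose (s + 1) := Nat.mul_le_mul_right _ hEG
          _ = m * (S.card * m.choose (s + 1)) := by ring
      have hchoose := Nat.add_one_mul_choose_eq m (s + 1)
      refine Nat.le_of_mul_le_mul_left ?_ (show 0 < s + 2 by omega)
      calc (s + 2) * ((m + 1) * (cliquesIn G S (s + 1 + 1)).card)
          = (m + 1) * ((s + 2) * (cliquesIn G S (s + 1 + 1)).card) := by ring
        _ ≤ (m + 1) * (S.card * m.choose (s + 1)) := Nat.mul_le_mul_left _ hmain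
        _ = S.card * ((m + 1) * m.choose (s + 1)) := by ring
        _ = (s + 2) * (S.card * (m + 1).choose (s + 1 + 1)) := by rw [hchoose]; ring

end Cliques

section Matching

variable {α β : Type*} [DecidableEq α] [DecidableEq β]

/-- Hall's theorem for a relation between two finite sets. -/
theorem exists_injOn_of_card_le [Nonempty β] (P : Finset α) (t : α → Finset β)
    (h : ∀ X ⊆ P, X.card ≤ (X.biUnion t).card) :
    ∃ f : α → β, Set.InjOn f P ∧ ∀ x ∈ P, f x ∈ t x := by
  obtain ⟨f, hf, hft⟩ := (Finset.all_card_le_biUnion_card_iff_exists_injective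
    (fun x : P => t x)).1 (by
      intro X
      have hX := h (X.map (Function.Embedding.subtype _)) (by
        intro x hx
        obtain ⟨y, -, rfl⟩ := Finset.mem_map.1 hx
        exact y.2)
      rw [Finset.card_map] at hX
      refine hX.trans (Finset.card_le_card fun b hb => ?_)
      obtain ⟨x, hx, hbx⟩ := Finset.mem_biUnion.1 hb
      obtain ⟨y, hy, rfl⟩ := Finset.mem_map.1 hx
      exact Finset.mem_biUnion.2 ⟨y, hy, hbx⟩)
  refine ⟨fun x => if hx : x ∈ P then f ⟨x, hx⟩ else Classical.arbitrary β, ?_, ?_⟩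
  · intro x hx y hy hxy
    rw [Finset.mem_coe] at hx hy
    simp only [hx, hy, dif_pos] at hxy
    exact congrArg Subtype.val (hf hxy)
  · intro x hx
    simp only [hx, dif_pos]
    exact hft ⟨x, hx⟩

/-- A set `A` of maximum deficiency splits `H`: its neighbourhood `B` is matched into `A`, while
`H \ A` is matched to a set `R` outside `B`. -/
theorem exists_deficiency_split [Nonempty α] [Nonempty β] (H : Finset β) (Γ : β → Finset α) :
    ∃ A ⊆ H, ∃ R : Finset α, Disjoint (A.biUnion Γ) R ∧ A.card + R.card = H.card ∧
      ∃ ψ : α → β, Set.InjOn ψ (A.biUnion Γ ∪ R : Finset α) ∧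
        ∀ p ∈ A.biUnion Γ ∪ R, ψ p ∈ H ∧ p ∈ Γ (ψ p) := by
  obtain ⟨A, hA, hmax⟩ := Finset.exists_max_image H.powerset
    (fun A => (A.card : ℤ) - (A.biUnion Γ).card) ⟨∅, Finset.empty_mem_powerset H⟩
  rw [Finset.mem_powerset] at hA
  set B := A.biUnion Γ with hB
  obtain ⟨φ, hφinj, hφ⟩ := exists_injOn_of_card_le B (fun p => A.filter (fun e => p ∈ Γ e)) (by
    intro Y hY
    set N := Y.biUnion fun p => A.filter (fun e => p ∈ Γ e) with hN
    have hNA : N ⊆ A := by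
      intro e he
      obtain ⟨p, -, he⟩ := Finset.mem_biUnion.1 he
      exact (Finset.mem_filter.1 he).1
    have hsub : (A \ N).biUnion Γ ⊆ B \ Y := by
      intro p hp
      obtain ⟨e, he, hpe⟩ := Finset.mem_biUnion.1 hp
      obtain ⟨heA, heN⟩ := Finset.mem_sdiff.1 he
      refine Finset.mem_sdiff.2 ⟨Finset.mem_biUnion.2 ⟨e, heA, hpe⟩, fun hpY => heN ?_⟩
      exact Finset.mem_biUnion.2 ⟨p, hpY, Finset.mem_filter.2 ⟨heA, hpe⟩⟩
    have h1 : ((A \ N).card : ℤ) - ((A \ N).biUnion Γ).card ≤ A.card - B.card :=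
      hmax (A \ N) (Finset.mem_powerset.2 (Finset.sdiff_subset.trans hA))
    have h2 := Finset.card_le_card hsub
    have h3 := Finset.card_sdiff_add_card_eq_card hNA
    have h4 := Finset.card_sdiff_add_card_eq_card hY
    omega)
  obtain ⟨f, hfinj, hf⟩ := exists_injOn_of_card_le (H \ A) (fun e => Γ e \ B) (by
    intro X hX
    have hdisj : Disjoint A X :=
      Finset.disjoint_of_subset_right hX Finset.disjoint_sdiff
    have hsub : (A ∪ X).biUnion Γ ⊆ B ∪ X.biUnion fun e => Γ e \ B := by
      intro p hp
      by_cases hpB : p ∈ B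
      · exact Finset.mem_union_left _ hpB
      · obtain ⟨e, he, hpe⟩ := Finset.mem_biUnion.1 hp
        rcases Finset.mem_union.1 he with he | he
        · exact absurd (Finset.mem_biUnion.2 ⟨e, he, hpe⟩) hpB
        · exact Finset.mem_union_right _
            (Finset.mem_biUnion.2 ⟨e, he, Finset.mem_sdiff.2 ⟨hpe, hpB⟩⟩)
    have h1 : ((A ∪ X).card : ℤ) - ((A ∪ X).biUnion Γ).card ≤ A.card - B.card := hmax (A ∪ X) (Finset.mem_powerset.2
      (Finset.union_subset hA (hX.trans Finset.sdiff_subset)))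
    have h2 := (Finset.card_le_card hsub).trans (Finset.card_union_le _ _)
    have h3 := Finset.card_union_of_disjoint hdisj
    omega)
  have hR : ∀ p ∈ (H \ A).image f, p ∉ B := by
    intro p hp
    obtain ⟨e, he, rfl⟩ := Finset.mem_image.1 hp
    exact (Finset.mem_sdiff.1 (hf e he)).2
  have hinv : ∀ p ∈ (H \ A).image f, Function.invFunOn f (H \ A : Finset β) p ∈ H \ A ∧
      f (Function.invFunOn f (H \ A : Finset β) p) = p := by
    intro p hp
    have hex : ∃ e ∈ ((H \ A : Finset β) : Set β), f e = p := by
      obtain ⟨e, he, hep⟩ := Finset.mem_image.1 hp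
      exact ⟨e, Finset.mem_coe.2 he, hep⟩
    exact ⟨Finset.mem_coe.1 (Function.invFunOn_mem hex), Function.invFunOn_eq hex⟩
  set g := Function.invFunOn f (H \ A : Finset β) with hg
  refine ⟨A, hA, (H \ A).image f, Finset.disjoint_right.2 hR, ?_,
    fun p => if p ∈ B then φ p else g p, ?_, ?_⟩
  · rw [Finset.card_image_of_injOn hfinj, add_comm, Finset.card_sdiff_add_card_eq_card hA]
  · intro p hp q hq hpq
    rw [Finset.mem_coe, Finset.mem_union] at hp hq
    by_cases hpB : p ∈ B <;> by_cases hqB : q ∈ B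
    · simp only [hpB, hqB, if_true] at hpq
      exact hφinj hpB hqB hpq
    · simp only [hpB, hqB, if_true, if_false] at hpq
      have h1 := (Finset.mem_filter.1 (hφ p hpB)).1
      have h2 := (Finset.mem_sdiff.1 (hinv q (hq.resolve_left hqB)).1).2
      exact absurd (hpq ▸ h1) h2
    · simp only [hpB, hqB, if_true, if_false] at hpq
      have h1 := (Finset.mem_filter.1 (hφ q hqB)).1
      have h2 := (Finset.mem_sdiff.1 (hinv p (hp.resolve_left hpB)).1).2
      exact absurd (hpq ▸ h1) h2
    · simp only [hpB, hqB, if_false] at hpq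
      rw [← (hinv p (hp.resolve_left hpB)).2, hpq, (hinv q (hq.resolve_left hqB)).2]
  · intro p hp
    by_cases hpB : p ∈ B
    · simp only [hpB, if_true]
      obtain ⟨h1, h2⟩ := Finset.mem_filter.1 (hφ p hpB)
      exact ⟨hA h1, h2⟩
    · simp only [hpB, if_false]
      obtain ⟨h1, h2⟩ := hinv p ((Finset.mem_union.1 hp).resolve_left hpB)
      refine ⟨(Finset.mem_sdiff.1 h1).1, ?_⟩
      have := (Finset.mem_sdiff.1 (hf _ h1)).1
      rwa [h2] at this

end Matching

section Hypergraph

variable {V : Type*}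

/-- The graph whose edges are the two-element members of `P`. -/
def pairGraph (P : Finset (Finset V)) : SimpleGraph V where
  Adj a b := a ≠ b ∧ {a, b} ∈ P
  symm := ⟨fun a b h => ⟨h.1.symm, Finset.pair_comm a b ▸ h.2⟩⟩
  loopless := ⟨fun _ h => h.1 rfl⟩

theorem pairGraph_mono {P Q : Finset (Finset V)} (h : P ⊆ Q) : pairGraph P ≤ pairGraph Q :=
  fun _ _ hab => ⟨hab.1, h hab.2⟩

/-- A path in a graph whose edges are represented by distinct hyperedges is a Berge-path. -/
theorem pathsBounded_of_isEmpty_bergePath [Fintype V] {H P : Finset (Finset V)} {k : ℕ}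
    (hH : IsEmpty (BergePath H k)) (ψ : Finset V → Finset V) (hψ : Set.InjOn ψ P)
    (hmem : ∀ p ∈ P, ψ p ∈ H ∧ p ⊆ ψ p) :
    PathsBounded (pairGraph P) Finset.univ k := by
  intro l hl
  by_contra! hlen
  have hadj : ∀ i (hi : i < k), (pairGraph P).Adj l[i] l[i + 1] := fun i hi =>
    List.isChain_iff_getElem.1 hl.2.1 i (by omega)
  have hinj : ∀ i j (hi : i < l.length) (hj : j < l.length), l[i] = l[j] → i = j :=
    fun i j hi hj h => (hl.1.getElem_inj_iff).1 h
  refine hH.elim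
    { verts := fun i => l[i.val]
      edges := fun i => ψ {l[i.val], l[i.val + 1]}
      verts_inj := fun i j h => Fin.ext (hinj _ _ _ _ h)
      edges_inj := fun i j h => ?_
      edges_mem := fun i => (hmem _ (hadj i i.2).2).1
      fst_mem := fun i => (hmem _ (hadj i i.2).2).2 (by simp)
      snd_mem := fun i => (hmem _ (hadj i i.2).2).2 (by simp) }
  have heq := hψ (hadj i i.2).2 (hadj j j.2).2 h
  have h1 : l[i.val] ∈ ({l[j.val], l[j.val + 1]} : Finset V) := heq ▸ by simp
  have h2 : l[i.val + 1] ∈ ({l[j.val], l[j.val + 1]} : Finset V) := heq ▸ by simp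
  rw [Finset.mem_insert, Finset.mem_singleton] at h1 h2
  have h1' := h1.imp (hinj _ _ _ _) (hinj _ _ _ _)
  have h2' := h2.imp (hinj _ _ _ _) (hinj _ _ _ _)
  exact Fin.ext (by omega)

theorem degIn_pairGraph_union {B R : Finset (Finset V)} (hBR : Disjoint B R) (S : Finset V)
    (v : V) :
    degIn (pairGraph (B ∪ R)) S v = degIn (pairGraph B) S v + degIn (pairGraph R) S v := by
  unfold degIn
  rw [← Finset.card_union_of_disjoint]
  · congr 1
    ext w
    rw [Finset.mem_union, Finset.mem_filter, Finset.mem_filter, Finset.mem_filter]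
    simp only [pairGraph, Finset.mem_union]
    tauto
  · rw [Finset.disjoint_left]
    intro w h1 h2
    exact Finset.disjoint_left.1 hBR (Finset.mem_filter.1 h1).2.2 (Finset.mem_filter.1 h2).2.2

theorem two_mul_card_le_sum_degIn [Fintype V] {R : Finset (Finset V)}
    (hR : ∀ p ∈ R, p.card = 2) :
    2 * R.card ≤ ∑ v, degIn (pairGraph R) Finset.univ v := by
  have hdc := Finset.sum_card_bipartiteAbove_eq_sum_card_bipartiteBelow
    (s := (Finset.univ : Finset V)) (t := R) (fun v p => v ∈ p)
  have hright : ∑ p ∈ R, (Finset.bipartiteBelow (fun v p => v ∈ p) Finset.univ p).card =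
      2 * R.card := by
    rw [Finset.sum_const_nat (m := 2), mul_comm]
    intro p hp
    rw [← hR p hp, Finset.bipartiteBelow, Finset.filter_univ_mem]
  rw [← hright, ← hdc]
  refine Finset.sum_le_sum fun v _ => ?_
  refine (Finset.card_le_card ?_).trans
    (Finset.card_image_le (s := Finset.univ.filter ((pairGraph R).Adj v)) (f := fun w => {v, w}))
  intro p hp
  obtain ⟨hp, hvp⟩ := Finset.mem_filter.1 hp
  obtain ⟨w, hw⟩ := Finset.card_eq_one.1
    (show (p.erase v).card = 1 by rw [Finset.card_erase_of_mem hvp, hR p hp])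
  have hpvw : p = {v, w} := by rw [← Finset.insert_erase hvp, hw]
  have hwv : w ≠ v := Finset.ne_of_mem_erase (hw ▸ Finset.mem_singleton_self w : w ∈ p.erase v)
  exact Finset.mem_image.2
    ⟨w, Finset.mem_filter.2 ⟨Finset.mem_univ _, hwv.symm, hpvw ▸ hp⟩, hpvw.symm⟩

end Hypergraph

theorem succ_mul_le_two_mul_choose {s m : ℕ} (hs : 1 ≤ s) (hm : s + 2 ≤ m) :
    (s + 1) * m ≤ 2 * m.choose s := by
  obtain ⟨s, rfl⟩ : ∃ t, s = t + 1 := ⟨s - 1, by omega⟩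
  obtain ⟨m, rfl⟩ : ∃ t, m = t + 1 := ⟨m - 1, by omega⟩
  have h1 := Nat.add_one_mul_choose_eq m s
  have h2 : (s + 2).choose s ≤ m.choose s := Nat.choose_le_choose s (by omega)
  have h3 : 2 * (s + 2).choose s = (s + 2) * (s + 1) := by
    rw [Nat.choose_symm_add, Nat.choose_two_right, Nat.mul_div_cancel']
    · simp
    · exact (Nat.even_mul_pred_self (s + 2)).two_dvd
  refine Nat.le_of_mul_le_mul_left ?_ (Nat.succ_pos s)
  calc (s + 1) * ((s + 1 + 1) * (m + 1)) = (m + 1) * ((s + 2) * (s + 1)) := by ring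
    _ = (m + 1) * (2 * (s + 2).choose s) := by rw [h3]
    _ ≤ (m + 1) * (2 * m.choose s) := by gcongr
    _ = 2 * ((m + 1) * m.choose s) := by ring
    _ = (s + 1) * (2 * (m + 1).choose (s + 1)) := by rw [h1]; ring

/-- A uniform hypergraph without Berge-paths of length `m + 1` has few hyperedges compared with
the size of some graph without paths on `m + 2` vertices. -/
theorem exists_graph_of_isEmpty_bergePath {V : Type*} [Fintype V] {H : Finset (Finset V)}
    {s m : ℕ} (hm : s + 3 ≤ m) (huni : ∀ e ∈ H, e.card = s + 2)
    (hH : IsEmpty (BergePath H (m + 1))) :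
    ∃ G : SimpleGraph V, PathsBounded G Finset.univ (m + 1) ∧
      m * ((s + 2) * H.card) ≤ (∑ v, degIn G Finset.univ v) * m.choose (s + 1) := by
  obtain ⟨A, hA, R, hdisj, hcard, ψ, hψ, hmem⟩ :=
    exists_deficiency_split H (fun e => e.powersetCard 2)
  set B := A.biUnion (fun e => e.powersetCard 2) with hB
  have hb : PathsBounded (pairGraph (B ∪ R)) Finset.univ (m + 1) :=
    pathsBounded_of_isEmpty_bergePath hH ψ hψ fun p hp =>
      ⟨(hmem p hp).1, (Finset.mem_powersetCard.1 (hmem p hp).2).1⟩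
  refine ⟨_, hb, ?_⟩
  have hbB : PathsBounded (pairGraph B) Finset.univ (m + 1) :=
    hb.mono subset_rfl (pairGraph_mono Finset.subset_union_left)
  have hAcl : A ⊆ cliquesIn (pairGraph B) Finset.univ (s + 2) := by
    intro e he
    refine mem_cliquesIn.2 ⟨⟨Finset.subset_univ _, huni e (hA he)⟩,
      fun a ha b hb hab => ⟨hab, Finset.mem_biUnion.2 ⟨e, he, Finset.mem_powersetCard.2 ⟨?_, ?_⟩⟩⟩⟩
    · exact Finset.insert_subset ha (Finset.singleton_subset_iff.2 hb)
    · exact Finset.card_pair hab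
  have hblue : m * ((s + 2) * A.card) ≤
      (∑ v, degIn (pairGraph B) Finset.univ v) * m.choose (s + 1) := by
    calc m * ((s + 2) * A.card)
        ≤ m * ∑ v, (cliquesIn (pairGraph B) (Finset.univ.filter ((pairGraph B).Adj v))
            (s + 1)).card :=
          Nat.mul_le_mul_left m ((Nat.mul_le_mul_left _ (Finset.card_le_card hAcl)).trans
            (succ_mul_card_cliquesIn_le (s + 1)))
      _ ≤ _ := by
          rw [Finset.mul_sum, Finset.sum_mul]
          exact Finset.sum_le_sum fun v _ =>
            (hbB.neighbors (Finset.mem_univ v)).card_cliquesIn_le (by omega)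
  have hRtwo : ∀ p ∈ R, p.card = 2 := fun p hp =>
    (Finset.mem_powersetCard.1 (hmem p (Finset.mem_union_right _ hp)).2).2
  have hred : m * ((s + 2) * R.card) ≤
      (∑ v, degIn (pairGraph R) Finset.univ v) * m.choose (s + 1) := by
    calc m * ((s + 2) * R.card) = ((s + 1 + 1) * m) * R.card := by ring
      _ ≤ (2 * m.choose (s + 1)) * R.card :=
          Nat.mul_le_mul_right _ (succ_mul_le_two_mul_choose (by omega) (by omega))
      _ = (2 * R.card) * m.choose (s + 1) := by ring
      _ ≤ _ := Nat.mul_le_mul_right _ (two_mul_card_le_sum_degIn hRtwo)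
  simp only [degIn_pairGraph_union hdisj, Finset.sum_add_distrib]
  rw [← hcard]
  linarith

/-- Győri–Katona–Lemons. For `k > r + 1 > 3`, every `r`-uniform
hypergraph on `n` vertices with no Berge-path of length `k` has at most `(n/k)·C(k,r)`
hyperedges; in case of equality `k ∣ n`. -/
theorem gyori_katona_lemons_large_k
    (n r k : ℕ) (hk : r + 1 < k) (hr : 3 < r + 1) (H : Finset (Finset (Fin n)))
    (huni : ∀ e ∈ H, e.card = r) (hpath : IsEmpty (BergePath H k)) :
    k * H.card ≤ n * k.choose r ∧ (k * H.card = n * k.choose r → k ∣ n) := by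
  obtain ⟨s, rfl⟩ : ∃ s, r = s + 2 := ⟨r - 2, by omega⟩
  obtain ⟨m, rfl⟩ : ∃ m, k = m + 1 := ⟨k - 1, by omega⟩
  obtain ⟨G, hb, hcount⟩ :=
    exists_graph_of_isEmpty_bergePath (by omega) huni hpath
  obtain ⟨hEG, hEGeq⟩ := hb.sum_degIn_le
  rw [Finset.card_univ, Fintype.card_fin] at hEG hEGeq
  have hm : 0 < m := by omega
  have hchoose : (m + 1) * m.choose (s + 1) = (m + 1).choose (s + 2) * (s + 2) :=
    Nat.add_one_mul_choose_eq m (s + 1)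
  have hscaled : m * (s + 2) * ((m + 1) * H.card) ≤
      (∑ v, degIn G Finset.univ v) * ((m + 1) * m.choose (s + 1)) := by
    calc m * (s + 2) * ((m + 1) * H.card) = (m + 1) * (m * ((s + 2) * H.card)) := by ring
      _ ≤ (m + 1) * ((∑ v, degIn G Finset.univ v) * m.choose (s + 1)) :=
          Nat.mul_le_mul_left _ hcount
      _ = _ := by ring
  have hbound : m * n * ((m + 1) * m.choose (s + 1)) =
      m * (s + 2) * (n * (m + 1).choose (s + 2)) := by
    rw [hchoose]
    ring
  refine ⟨?_, fun heq => ?_⟩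
  · refine Nat.le_of_mul_le_mul_left ?_ (show 0 < m * (s + 2) by positivity)
    rw [← hbound]
    exact hscaled.trans (Nat.mul_le_mul_right _ hEG)
  · have hpos : 0 < (m + 1) * m.choose (s + 1) :=
      Nat.mul_pos (Nat.succ_pos m) (Nat.choose_pos (by omega))
    rw [heq, ← hbound] at hscaled
    have hsum := le_antisymm hEG (Nat.le_of_mul_le_mul_right hscaled hpos)
    simpa using (hEGeq hm hsum).dvd_card
end
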